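/- Let G be a countable group admitting a right Følner sequence, Σ a nonempty finite alphabet, and Ω a relative system over G with alphabet Σ whose environment space Θ is a standard Borel space and whose fibers X_θ are nonempty for every θ ∈ Θ. Assume Ω satisfies the weak topological Markov property relative to Θ. Let ν be a G-invariant probability measure on Θ and Φ an absolutely summable relative interaction on Ω. Then there exists a G-invariant probability measure μ on Ω whose pushforward to Θ is ν and which is a relative Gibbs measure for Φ, i.e., μK_A = μ for every finite A ⊆ G. -/

import Mathlib

open MeasureTheory Filter Topology
open scoped Pointwise ENNReal
noncomputable section

namespace DLR

variable (G : Type) [Group G] [Countable G] [DecidableEq G]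
variable (S : Type) [Fintype S] [Nonempty S] [TopologicalSpace S] [DiscreteTopology S]
  [MeasurableSpace S] [MeasurableSingletonClass S]
variable (Θ : Type) [MeasurableSpace Θ]

/-- The translation action of `G` on configurations: `(g • x)_k = x_{g⁻¹ k}`. -/
def shift (g : G) (x : G → S) : G → S := fun k => x (g⁻¹ * k)

/-- A relative system over `G` with alphabet `S` and environment space `Θ`. -/
structure RelSystem where
  act : G → Θ → Θ
  act_one : ∀ θ, act 1 θ = θ
  act_mul : ∀ g h θ, act (g * h) θ = act g (act h θ)
  act_measurable : ∀ g, Measurable (act g)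
  X : Θ → Set (G → S)
  X_closed : ∀ θ, IsClosed (X θ)
  omega_measurable : MeasurableSet {p : Θ × (G → S) | p.2 ∈ X p.1}
  X_equivariant : ∀ g θ, X (act g θ) = (shift G S g) '' (X θ)

variable {G S Θ}

/-- The total space of a relative system, as a subset of `Θ × Σ^G`. -/
def RelSystem.Omega (R : RelSystem G S Θ) : Set (Θ × (G → S)) := {p | p.2 ∈ R.X p.1}

/-- The σ-algebra on `Θ × Σ^G` generated by the environment coordinate. -/
def FTheta : MeasurableSpace (Θ × (G → S)) := MeasurableSpace.comap Prod.fst inferInstance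

/-- The σ-algebra on `Θ × Σ^G` generated by the configuration restricted to `B ⊆ G`. -/
def xi (B : Set G) : MeasurableSpace (Θ × (G → S)) :=
  MeasurableSpace.comap (fun p => (fun b : B => p.2 b)) inferInstance

/-- The cylinder set of a pattern `u` with support a finite set `A ⊆ G`. -/
def cyl (A : Finset G) (u : A → S) : Set (Θ × (G → S)) := {p | ∀ a : A, p.2 a = u a}

/-- Merging a pattern `u` on `A` with a configuration `x` off `A`: `x_{G∖A} ∨ u`. -/
def mergePat (A : Finset G) (x : G → S) (u : A → S) : G → S :=
  fun k => if h : k ∈ A then u ⟨k, h⟩ else x k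

/-- A bounded relatively continuous observable (membership in `C_Θ(Ω)`). -/
def RelCont (R : RelSystem G S Θ) (f : Θ × (G → S) → ℝ) : Prop :=
  Measurable f ∧ (∃ c : ℝ, ∀ p ∈ R.Omega, |f p| ≤ c) ∧
    ∀ ε > 0, ∃ A : Finset G, ∀ θ : Θ, ∀ x ∈ R.X θ, ∀ y ∈ R.X θ,
      (∀ a ∈ A, x a = y a) → |f (θ, x) - f (θ, y)| < ε

variable (G S Θ) in
/-- A relative interaction on a relative system. -/
structure Interaction (R : RelSystem G S Θ) where
  Phi : Finset G → Θ × (G → S) → ℝ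
  measurable' : ∀ A : Finset G, Measurable[FTheta ⊔ xi (↑A : Set G)] (Phi A)
  bounded' : ∀ A : Finset G, ∃ c : ℝ, ∀ p, |Phi A p| ≤ c
  equivariant' : ∀ (g : G) (A : Finset G) (p : Θ × (G → S)),
    Phi (A.image (g * ·)) p = Phi A (R.act g⁻¹ p.1, shift G S g⁻¹ p.2)

variable {R : RelSystem G S Θ}

/-- The supremum norm of the `A`-component of an interaction. -/
def supAbs {α : Type} (f : α → ℝ) : ℝ := ⨆ p, |f p|

/-- Absolute summability of a relative interaction. -/
def Interaction.AbsSummable (Φ : Interaction G S Θ R) : Prop :=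
  Summable (fun A : Finset G => if (1 : G) ∈ A then supAbs (Φ.Phi A) else 0)

/-- The norm `‖Φ‖` of an absolutely summable interaction. -/
def Interaction.norm (Φ : Interaction G S Θ R) : ℝ :=
  ∑' A : Finset G, if (1 : G) ∈ A then supAbs (Φ.Phi A) else 0

/-- The energy `E_A = Σ_{C ⊆ A} Φ_C` of a finite region `A`. -/
def energy (Φ : Interaction G S Θ R) (A : Finset G) (p : Θ × (G → S)) : ℝ :=
  ∑ C ∈ A.powerset, Φ.Phi C p

/-- The conditional energy `E_{A|A^c} = Σ_{C ∩ A ≠ ∅} Φ_C`. -/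
def condEnergy (Φ : Interaction G S Θ R) (A : Finset G) (p : Θ × (G → S)) : ℝ :=
  ∑' C : Finset G, if (C ∩ A).Nonempty then Φ.Phi C p else 0

/-- The conditional energy `E_{A|B} = E_{A∪B} - E_B` for finite `A`, `B`. -/
def condEnergyFin (Φ : Interaction G S Θ R) (A B : Finset G) (p : Θ × (G → S)) : ℝ :=
  energy Φ (A ∪ B) p - energy Φ B p

open Classical in
/-- The partition function `Z_{A|A^c}(θ,x)`. -/
def partitionZ (Φ : Interaction G S Θ R) (A : Finset G) (p : Θ × (G → S)) : ℝ :=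
  ∑ u : A → S, if mergePat A p.2 u ∈ R.X p.1
    then Real.exp (-(condEnergy Φ A (p.1, mergePat A p.2 u))) else 0

open Classical in
/-- The Gibbs kernel `K_A((θ,x),·)` associated to an interaction. -/
def gibbsKernel (Φ : Interaction G S Θ R) (A : Finset G) (p : Θ × (G → S)) :
    Measure (Θ × (G → S)) :=
  ∑ u : A → S, if mergePat A p.2 u ∈ R.X p.1
    then (ENNReal.ofReal (Real.exp (-(condEnergy Φ A (p.1, mergePat A p.2 u))) /
            partitionZ Φ A p)) • Measure.dirac (p.1, mergePat A p.2 u)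
    else 0

/-- Conditional entropy `H_μ(ξ^A | m)` of the partition into `A`-cylinders given
a sub-σ-algebra `m`, defined via conditional expectation. -/
def condEntropy (μ : Measure (Θ × (G → S))) (A : Finset G)
    (m : MeasurableSpace (Θ × (G → S))) : ℝ :=
  ∫ p, (∑ u : A → S,
    Real.negMulLog ((μ[Set.indicator (cyl A u) (fun _ => (1:ℝ)) | m]) p)) ∂μ

/-- The conditional relative pressure `Ψ_μ(A | A^c)`. -/
def pressureCond (Φ : Interaction G S Θ R) (μ : Measure (Θ × (G → S))) (A : Finset G) : ℝ :=
  condEntropy μ A (xi ((↑A : Set G)ᶜ) ⊔ FTheta) - ∫ p, condEnergy Φ A p ∂μ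

/-- The conditional relative pressure `Ψ_μ(A | B)` for finite disjoint `A`, `B`. -/
def pressureCondFin (Φ : Interaction G S Θ R) (μ : Measure (Θ × (G → S)))
    (A B : Finset G) : ℝ :=
  condEntropy μ A (xi (↑B : Set G) ⊔ FTheta) - ∫ p, condEnergyFin Φ A B p ∂μ

/-- Weak topological Markov property relative to `Θ`. -/
def RelSystem.WeakTMP (R : RelSystem G S Θ) : Prop :=
  ∀ A : Finset G, ∃ B : Finset G, A ⊆ B ∧ ∀ θ : Θ, ∀ x ∈ R.X θ, ∀ x' ∈ R.X θ,
    (∀ g ∈ B \ A, x g = x' g) → (fun g => if g ∈ B then x g else x' g) ∈ R.X θ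

/-- A right Følner sequence in a countable group. -/
def RightFolner (F : ℕ → Finset G) : Prop :=
  (∀ n, (F n).Nonempty) ∧
  ∀ g : G, Tendsto (fun n => ((symmDiff (F n) ((F n).image (· * g))).card : ℝ) / (F n).card)
    atTop (𝓝 0)

set_option linter.unusedSectionVars false

/-! ### Analytic sets are null measurable -/

section Analytic

/-- The Choquet capacitability argument: a continuous image of Baire space can be approximated
from inside, in measure, by compact sets. -/
theorem exists_isCompact_subset_range {X : Type*} [TopologicalSpace X] [MeasurableSpace X]
    (μ : Measure X) [μ.OuterRegular] {f : (ℕ → ℕ) → X} (hf : Continuous f) {c : ℝ≥0∞}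
    (hc : c < μ (Set.range f)) :
    ∃ K ⊆ Set.range f, IsCompact K ∧ c ≤ μ K := by
  have step : ∀ (n : ℕ) (T : {T : Set (ℕ → ℕ) // c < μ (f '' T)}),
      ∃ m : ℕ, c < μ (f '' (T.1 ∩ {y | y n ≤ m})) := by
    rintro n ⟨T, hT⟩
    have hU : f '' T = ⋃ m : ℕ, f '' (T ∩ {y | y n ≤ m}) := by
      rw [← Set.image_iUnion, ← Set.inter_iUnion]
      congr 1
      ext y
      simp only [Set.mem_inter_iff, Set.mem_iUnion, Set.mem_ofPred_eq, iff_self_and]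
      exact fun _ => ⟨y n, le_rfl⟩
    have hmono : Monotone fun m : ℕ => f '' (T ∩ {y | y n ≤ m}) := by
      intro a b hab
      refine Set.image_mono (Set.inter_subset_inter_right _ ?_)
      intro y hy
      exact le_trans hy hab
    rw [hU, hmono.measure_iUnion] at hT
    exact lt_iSup_iff.1 hT
  choose m hm using step
  let T : ℕ → {T : Set (ℕ → ℕ) // c < μ (f '' T)} := fun n =>
    Nat.rec ⟨Set.univ, by rwa [Set.image_univ]⟩ (fun n T => ⟨T.1 ∩ {y | y n ≤ m n T}, hm n T⟩) n
  let b : ℕ → ℕ := fun n => m n (T n)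
  have hT : ∀ n, ∀ y ∈ (T n).1, ∀ i < n, y i ≤ b i := by
    intro n
    induction n with
    | zero => intro y _ i hi; omega
    | succ n ih =>
      intro y hy i hi
      have hy' : y ∈ (T n).1 ∩ {y | y n ≤ m n (T n)} := hy
      rcases Nat.lt_succ_iff_lt_or_eq.1 hi with h | rfl
      · exact ih y hy'.1 i h
      · exact hy'.2
  let L : Set (ℕ → ℕ) := Set.pi Set.univ fun i => Set.Iic (b i)
  have hL : IsCompact L := isCompact_univ_pi fun i => (Set.finite_Iic (b i)).isCompact
  refine ⟨f '' L, Set.image_subset_range _ _, hL.image hf, ?_⟩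
  rw [Set.measure_eq_iInf_isOpen]
  refine le_iInf fun U => le_iInf fun hLU => le_iInf fun hU => ?_
  suffices h : ∃ n, (T n).1 ⊆ f ⁻¹' U by
    obtain ⟨n, hn⟩ := h
    exact (T n).2.le.trans (measure_mono (Set.image_subset_iff.2 hn))
  by_contra! hcon
  have hex : ∀ n, ∃ y ∈ (T n).1, f y ∉ U := fun n => Set.not_subset.1 (hcon n)
  choose y hyT hyU using hex
  have hz : ∀ n, (fun i => min (y n i) (b i)) ∈ L := fun n i _ => Set.mem_Iic.2 (min_le_right _ _)
  obtain ⟨z, hzL, φ, hφ, hlim⟩ := hL.tendsto_subseq hz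
  have hlim' : Tendsto (fun k => y (φ k)) atTop (𝓝 z) := by
    rw [tendsto_pi_nhds] at hlim ⊢
    intro i
    refine (hlim i).congr' ?_
    filter_upwards [eventually_gt_atTop i] with k hk
    exact min_eq_left (hT _ _ (hyT _) i (hk.trans_le (hφ.id_le k)))
  have hev := ((hf.tendsto z).comp hlim').eventually
    (hU.mem_nhds (hLU (Set.mem_image_of_mem f hzL)))
  obtain ⟨k, hk⟩ := hev.exists
  exact hyU _ hk

/-- Analytic sets in Polish spaces are measurable with respect to the completion of every
finite Borel measure. -/
theorem nullMeasurableSet_of_analyticSet {X : Type*} [TopologicalSpace X] [PolishSpace X]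
    [MeasurableSpace X] [BorelSpace X] (μ : Measure X) [IsFiniteMeasure μ] {s : Set X}
    (hs : AnalyticSet s) : NullMeasurableSet s μ := by
  rw [AnalyticSet] at hs
  rcases hs with rfl | ⟨f, hf, rfl⟩
  · exact MeasurableSet.empty.nullMeasurableSet
  rcases eq_or_ne (μ (Set.range f)) 0 with h0 | h0
  · exact NullMeasurableSet.of_null h0
  obtain ⟨u, -, hu, hlim⟩ := exists_seq_strictMono_tendsto' (pos_iff_ne_zero.2 h0)
  choose K hKs hK hKμ using fun n => exists_isCompact_subset_range μ hf (hu n).2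
  have hM : MeasurableSet (⋃ n, K n) := MeasurableSet.iUnion fun n => (hK n).measurableSet
  have hle : μ (Set.range f) ≤ μ (⋃ n, K n) :=
    le_of_tendsto' hlim fun n => (hKμ n).trans (measure_mono (Set.subset_iUnion K n))
  have hae : (⋃ n, K n) =ᵐ[μ] Set.range f :=
    ae_eq_of_subset_of_measure_ge (Set.iUnion_subset hKs) hle hM.nullMeasurableSet
      (measure_ne_top _ _)
  exact hM.nullMeasurableSet.congr hae

end Analytic

/-! ### Relatively uniformly continuous observables -/

section Observables

/-- The configuration that equals `y` on `A` and `x` off `A`. -/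
def glue (A : Finset G) (y x : G → S) : G → S := fun k => if k ∈ A then y k else x k

/-- Gluing the pattern of `y` on `A` into the configuration coordinate. -/
def glueMap (A : Finset G) (y : G → S) (p : Θ × (G → S)) : Θ × (G → S) := (p.1, glue A y p.2)

/-- An extension of a finite pattern to a full configuration. -/
def extend (A : Finset G) (u : A → S) : G → S :=
  fun k => if h : k ∈ A then u ⟨k, h⟩ else Classical.arbitrary S

theorem extend_apply_mem {A : Finset G} (u : A → S) {a : G} (ha : a ∈ A) :
    extend A u a = u ⟨a, ha⟩ := dif_pos ha

theorem extend_restrict {A : Finset G} (x : G → S) :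
    ∀ a ∈ A, extend A (fun b : A => x b) a = x a := fun _ ha => extend_apply_mem _ ha

theorem mergePat_eq_glue (A : Finset G) (x : G → S) (u : A → S) :
    mergePat A x u = glue A (extend A u) x := by
  ext k
  by_cases hk : k ∈ A <;> simp [mergePat, glue, extend, hk]

theorem measurable_glueMap (A : Finset G) (y : G → S) :
    Measurable (glueMap (Θ := Θ) A y) := by
  refine measurable_fst.prodMk (measurable_pi_lambda _ fun k => ?_)
  by_cases hk : k ∈ A
  · simp only [glue, hk, if_true]; exact measurable_const
  · simp only [glue, hk, if_false]; exact (measurable_pi_apply k).comp measurable_snd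

/-- Functions of the environment and of finitely many coordinates are measurable as soon as they
are measurable in the environment. -/
theorem measurable_of_local {β : Type*} [MeasurableSpace β] (A : Finset G)
    {h : Θ × (G → S) → β} (hm : ∀ x, Measurable fun θ => h (θ, x))
    (hl : ∀ θ x y, (∀ a ∈ A, x a = y a) → h (θ, x) = h (θ, y)) : Measurable h := by
  have hk : Measurable fun q : Θ × (A → S) => h (q.1, extend A q.2) :=
    measurable_from_prod_countable_left fun u => hm (extend A u)
  have hr : Measurable fun p : Θ × (G → S) => (p.1, fun a : A => p.2 a) := by fun_prop
  have : h = (fun q : Θ × (A → S) => h (q.1, extend A q.2)) ∘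
      fun p : Θ × (G → S) => (p.1, fun a : A => p.2 a) := by
    ext ⟨θ, x⟩
    exact hl θ _ _ fun a ha => (extend_restrict x a ha).symm
  rw [this]
  exact hk.comp hr

/-- Bounded measurable functions that are uniformly approximable by their values on finitely many
coordinates, uniformly in the environment. -/
structure UnifCont (h : Θ × (G → S) → ℝ) : Prop where
  measurable : Measurable h
  bounded : ∃ c : ℝ, ∀ p, |h p| ≤ c
  local_approx : ∀ ε > 0, ∃ A : Finset G, ∀ θ x y, (∀ a ∈ A, x a = y a) →
    |h (θ, x) - h (θ, y)| ≤ ε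

theorem UnifCont.of_local (A : Finset G) {h : Θ × (G → S) → ℝ}
    (hm : ∀ x, Measurable fun θ => h (θ, x)) (hb : ∃ c : ℝ, ∀ p, |h p| ≤ c)
    (hl : ∀ θ x y, (∀ a ∈ A, x a = y a) → h (θ, x) = h (θ, y)) : UnifCont h where
  measurable := measurable_of_local A hm hl
  bounded := hb
  local_approx ε hε := ⟨A, fun θ x y hxy => by rw [hl θ x y hxy, sub_self, abs_zero]; exact hε.le⟩

open Classical in
theorem UnifCont.indicator_of_local (A : Finset G) {D : Set (Θ × (G → S))}
    (hm : ∀ x, MeasurableSet {θ | (θ, x) ∈ D})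
    (hl : ∀ θ x y, (∀ a ∈ A, x a = y a) → ((θ, x) ∈ D ↔ (θ, y) ∈ D)) :
    UnifCont (D.indicator fun _ => (1 : ℝ)) := by
  refine .of_local A (fun x => ?_) ⟨1, fun p => ?_⟩ fun θ x y hxy => ?_
  · exact (measurable_const (a := (1 : ℝ))).indicator (hm x)
  · by_cases hp : p ∈ D <;> simp [hp]
  · simp only [Set.indicator, hl θ x y hxy]

theorem UnifCont.mul {h k : Θ × (G → S) → ℝ} (hh : UnifCont h) (hk : UnifCont k) :
    UnifCont fun p => h p * k p := by
  obtain ⟨c, hc⟩ := hh.bounded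
  obtain ⟨d, hd⟩ := hk.bounded
  refine ⟨hh.measurable.mul hk.measurable, ⟨|c| * |d|, fun p => ?_⟩, fun ε hε => ?_⟩
  · rw [abs_mul]
    exact mul_le_mul ((hc p).trans (le_abs_self c)) ((hd p).trans (le_abs_self d))
      (abs_nonneg _) (abs_nonneg _)
  · have hM : 0 < |c| + |d| + 1 := by positivity
    obtain ⟨A, hA⟩ := hh.local_approx (ε / (|c| + |d| + 1)) (by positivity)
    obtain ⟨B, hB⟩ := hk.local_approx (ε / (|c| + |d| + 1)) (by positivity)
    refine ⟨A ∪ B, fun θ x y hxy => ?_⟩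
    have h1 := hA θ x y fun a ha => hxy a (Finset.mem_union_left _ ha)
    have h2 := hB θ x y fun a ha => hxy a (Finset.mem_union_right _ ha)
    have h3 : |h (θ, x)| ≤ |c| := (hc _).trans (le_abs_self c)
    have h4 : |k (θ, y)| ≤ |d| := (hd _).trans (le_abs_self d)
    have e : h (θ, x) * k (θ, x) - h (θ, y) * k (θ, y) =
      h (θ, x) * (k (θ, x) - k (θ, y)) + (h (θ, x) - h (θ, y)) * k (θ, y) := by ring
    calc |h (θ, x) * k (θ, x) - h (θ, y) * k (θ, y)|
        ≤ |h (θ, x)| * |k (θ, x) - k (θ, y)| + |h (θ, x) - h (θ, y)| * |k (θ, y)| := by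
          rw [e, ← abs_mul, ← abs_mul]; exact abs_add_le _ _
      _ ≤ |c| * (ε / (|c| + |d| + 1)) + ε / (|c| + |d| + 1) * |d| := by gcongr
      _ = ε * ((|c| + |d|) / (|c| + |d| + 1)) := by ring
      _ ≤ ε * 1 := by
          gcongr
          rw [div_le_one hM]
          linarith
      _ = ε := mul_one ε

theorem UnifCont.exp_neg {h : Θ × (G → S) → ℝ} (hh : UnifCont h) :
    UnifCont fun p => Real.exp (-h p) := by
  obtain ⟨c, hc⟩ := hh.bounded
  refine ⟨hh.measurable.neg.exp, ⟨Real.exp c, fun p => ?_⟩, fun ε hε => ?_⟩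
  · rw [Real.abs_exp]
    exact Real.exp_le_exp.2 (neg_le.1 (neg_le_of_abs_le (hc p)))
  · have huc : UniformContinuousOn (fun t : ℝ => Real.exp (-t)) (Set.Icc (-c) c) :=
      isCompact_Icc.uniformContinuousOn_of_continuous (by fun_prop)
    obtain ⟨δ, hδ, hδ'⟩ := Metric.uniformContinuousOn_iff.1 huc ε hε
    obtain ⟨A, hA⟩ := hh.local_approx (δ / 2) (by positivity)
    refine ⟨A, fun θ x y hxy => ?_⟩
    have := hδ' (h (θ, x)) (abs_le.1 (hc _)) (h (θ, y)) (abs_le.1 (hc _))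
      (by rw [Real.dist_eq]; linarith [hA θ x y hxy])
    rw [Real.dist_eq] at this
    exact this.le

theorem UnifCont.comp_glueMap {h : Θ × (G → S) → ℝ} (hh : UnifCont h) (A : Finset G)
    (z : G → S) : UnifCont fun p => h (glueMap A z p) := by
  refine ⟨hh.measurable.comp (measurable_glueMap A z), ?_, fun ε hε => ?_⟩
  · exact hh.bounded.imp fun c hc p => hc _
  · obtain ⟨B, hB⟩ := hh.local_approx ε hε
    refine ⟨B, fun θ x y hxy => hB θ _ _ fun a ha => ?_⟩
    simp only [glue, hxy a ha]

theorem UnifCont.integrable {h : Θ × (G → S) → ℝ} (hh : UnifCont h)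
    (μ : Measure (Θ × (G → S))) [IsFiniteMeasure μ] : Integrable h μ := by
  obtain ⟨c, hc⟩ := hh.bounded
  exact Integrable.of_bound hh.measurable.aestronglyMeasurable c (ae_of_all _ hc)

/-- The rectangles with measurable environment side and cylindrical configuration side. -/
def boxes (Θ G S : Type) [MeasurableSpace Θ] [MeasurableSpace S] : Set (Set (Θ × (G → S))) :=
  Set.image2 (· ×ˢ ·) {E : Set Θ | MeasurableSet E} (measurableCylinders fun _ : G => S)

theorem isPiSystem_boxes : IsPiSystem (boxes Θ G S) :=
  MeasurableSpace.isPiSystem_measurableSet.prod isPiSystem_measurableCylinders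

theorem generateFrom_boxes :
    (inferInstance : MeasurableSpace (Θ × (G → S))) = .generateFrom (boxes Θ G S) := by
  refine (generateFrom_eq_prod MeasurableSpace.generateFrom_measurableSet
    generateFrom_measurableCylinders ?_ ?_).symm
  · exact ⟨fun _ => Set.univ, fun _ => MeasurableSet.univ, Set.iUnion_const _⟩
  · exact ⟨fun _ => Set.univ, fun _ => univ_mem_measurableCylinders _, Set.iUnion_const _⟩

theorem UnifCont.indicator_box {D : Set (Θ × (G → S))} (hD : D ∈ boxes Θ G S) :
    UnifCont (D.indicator fun _ => (1 : ℝ)) := by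
  obtain ⟨E, hE, C, hC, rfl⟩ := hD
  obtain ⟨A, T, hT, rfl⟩ := (mem_measurableCylinders _).1 hC
  refine .indicator_of_local A (fun x => ?_) fun θ x y hxy => ?_
  · by_cases hx : A.restrict x ∈ T
    · simpa [hx] using hE
    · simp [hx]
  · have : A.restrict x = A.restrict y := funext fun a => hxy a a.2
    simp [this]

theorem measurableSet_of_mem_boxes {D : Set (Θ × (G → S))} (hD : D ∈ boxes Θ G S) :
    MeasurableSet D := by
  obtain ⟨E, hE, C, hC, rfl⟩ := hD
  exact MeasurableSet.prod hE (MeasurableSet.of_mem_measurableCylinders hC)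

/-- Finite measures are determined by their values on boxes. -/
theorem measure_ext_of_boxes {μ ρ : Measure (Θ × (G → S))} [IsFiniteMeasure μ]
    (h : ∀ D ∈ boxes Θ G S, μ D = ρ D) : μ = ρ := by
  refine ext_of_generate_finite _ generateFrom_boxes isPiSystem_boxes h (h _ ?_)
  exact ⟨_, MeasurableSet.univ, _, univ_mem_measurableCylinders _, Set.univ_prod_univ⟩

end Observables

/-! ### Compactness of the measures with a given marginal -/

section Compactness

theorem exists_continuous_approx [TopologicalSpace Θ] [PolishSpace Θ] [BorelSpace Θ]
    (ν : Measure Θ) [IsProbabilityMeasure ν] {h : Θ × (G → S) → ℝ} (hh : UnifCont h)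
    {ε : ℝ} (hε : 0 < ε) :
    ∃ H : BoundedContinuousFunction (Θ × (G → S)) ℝ, ∀ μ : Measure (Θ × (G → S)),
      IsProbabilityMeasure μ → μ.map Prod.fst = ν → |∫ p, h p ∂μ - ∫ p, H p ∂μ| ≤ ε := by
  classical
  have : BorelSpace S := ⟨by
    rw [borel_eq_top_of_discrete]
    exact eq_top_iff.2 fun s _ => s.toFinite.measurableSet⟩
  obtain ⟨c, hc⟩ := hh.bounded
  obtain ⟨A, hA⟩ := hh.local_approx (ε / 2) (by positivity)
  have hφm : ∀ u : A → S, Measurable fun θ => h (θ, extend A u) := fun u =>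
    hh.measurable.comp (measurable_id.prodMk measurable_const)
  have hφ : ∀ u : A → S, Integrable (fun θ => h (θ, extend A u)) ν := fun u =>
    Integrable.of_bound (hφm u).aestronglyMeasurable c (ae_of_all _ fun θ => hc _)
  have hδ : 0 < ε / (2 * (Fintype.card (A → S) : ℝ)) := by
    have : 0 < Fintype.card (A → S) := Fintype.card_pos
    positivity
  choose g hg hgi using fun u => (hφ u).exists_boundedContinuous_integral_sub_le hδ
  have hcl : ∀ u : A → S, IsClopen {p : Θ × (G → S) | (fun a : A => p.2 a) = u} := fun u =>
    (isClopen_discrete {u}).preimage (f := fun p : Θ × (G → S) => fun a : A => p.2 a)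
      (by fun_prop)
  let H₀ : Θ × (G → S) → ℝ := fun p => ∑ u : A → S,
    {p : Θ × (G → S) | (fun a : A => p.2 a) = u}.indicator (fun p => g u p.1) p
  have hH₀ : ∀ p, H₀ p = g (fun a : A => p.2 a) p.1 := by
    intro p
    simp only [H₀]
    rw [Finset.sum_eq_single (fun a : A => p.2 a)]
    · exact Set.indicator_of_mem (s := {q : Θ × (G → S) | (fun a : A => q.2 a) = fun a : A => p.2 a}) rfl _
    · intro u _ hu
      exact Set.indicator_of_notMem (fun h => hu h.symm) _
    · simp
  have hH₀c : Continuous H₀ := continuous_finsetSum _ fun u _ =>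
    ((g u).continuous.comp continuous_fst).indicator (fun a ha => by
      rw [(hcl u).frontier_eq] at ha; exact absurd ha (Set.notMem_empty _))
  have hH₀b : ∀ p, ‖H₀ p‖ ≤ ∑ u, ‖g u‖ := by
    intro p
    rw [hH₀]
    exact ((g _).norm_coe_le_norm _).trans
      (Finset.single_le_sum (f := fun u => ‖g u‖) (fun _ _ => norm_nonneg _) (Finset.mem_univ _))
  refine ⟨BoundedContinuousFunction.ofNormedAddCommGroup H₀ hH₀c _ hH₀b, fun μ hμ hμν => ?_⟩
  have hHi : Integrable H₀ μ := Integrable.of_bound hH₀c.aestronglyMeasurable _ (ae_of_all _ hH₀b)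
  change |∫ p, h p ∂μ - ∫ p, H₀ p ∂μ| ≤ ε
  rw [← integral_sub (hh.integrable μ) hHi]
  have hdi : ∀ u : A → S, Integrable (fun p : Θ × (G → S) => ‖h (p.1, extend A u) - g u p.1‖) μ := by
    intro u
    have : Integrable (fun θ => ‖h (θ, extend A u) - g u θ‖) (μ.map Prod.fst) := by
      rw [hμν]; exact ((hφ u).sub (hgi u)).norm
    exact this.comp_measurable measurable_fst
  have hd : ∀ u : A → S, ∫ p : Θ × (G → S), ‖h (p.1, extend A u) - g u p.1‖ ∂μ ≤
      ε / (2 * (Fintype.card (A → S) : ℝ)) := by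
    intro u
    refine le_trans (le_of_eq ?_) (hg u)
    rw [← hμν, integral_map measurable_fst.aemeasurable]
    exact ((hφm u).sub (g u).continuous.measurable).norm.aestronglyMeasurable
  calc |∫ p, (h p - H₀ p) ∂μ| ≤ ∫ p, |h p - H₀ p| ∂μ := abs_integral_le_integral_abs
    _ ≤ ∫ p, (ε / 2 + ∑ u : A → S, ‖h (p.1, extend A u) - g u p.1‖) ∂μ := by
        refine integral_mono ((hh.integrable μ).sub hHi).abs
          ((integrable_const _).add (integrable_finsetSum _ fun u _ => hdi u)) fun p => ?_
        have h1 := hA p.1 p.2 (extend A fun a : A => p.2 a)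
          fun a ha => (extend_restrict p.2 a ha).symm
        have h2 : ‖h (p.1, extend A fun a : A => p.2 a) - H₀ p‖ ≤
            ∑ u : A → S, ‖h (p.1, extend A u) - g u p.1‖ := by
          rw [hH₀]
          exact Finset.single_le_sum (f := fun u : A → S => ‖h (p.1, extend A u) - g u p.1‖)
            (fun _ _ => norm_nonneg _) (Finset.mem_univ (fun a : A => p.2 a))
        exact (abs_sub_le _ _ _).trans (add_le_add h1 h2)
    _ = ε / 2 + ∑ u : A → S, ∫ p, ‖h (p.1, extend A u) - g u p.1‖ ∂μ := by
        rw [integral_add (integrable_const _) (integrable_finsetSum _ fun u _ => hdi u),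
          integral_finsetSum _ fun u _ => hdi u]
        simp
    _ ≤ ε / 2 + ∑ u : A → S, ε / (2 * (Fintype.card (A → S) : ℝ)) := by
        gcongr with u
        exact hd u
    _ = ε := by
        have : (Fintype.card (A → S) : ℝ) ≠ 0 := Nat.cast_ne_zero.2 Fintype.card_ne_zero
        rw [Finset.sum_const, Finset.card_univ, nsmul_eq_mul]
        field_simp
        ring

/-- Any family of probability measures with a fixed marginal converges along any ultrafilter
when tested against relatively uniformly continuous observables. -/
theorem exists_ultrafilter_limit [StandardBorelSpace Θ] (ν : Measure Θ) [IsProbabilityMeasure ν]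
    {ι : Type*} (l : Ultrafilter ι) (μ : ι → Measure (Θ × (G → S)))
    (hμ : ∀ i, IsProbabilityMeasure (μ i)) (hμν : ∀ i, (μ i).map Prod.fst = ν) :
    ∃ ρ : Measure (Θ × (G → S)), IsProbabilityMeasure ρ ∧ ρ.map Prod.fst = ν ∧
      ∀ h, UnifCont h → Tendsto (fun i => ∫ p, h p ∂(μ i)) l (𝓝 (∫ p, h p ∂ρ)) := by
  let _ := upgradeStandardBorel Θ
  have : BorelSpace S := ⟨by
    rw [borel_eq_top_of_discrete]
    exact eq_top_iff.2 fun s _ => s.toFinite.measurableSet⟩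
  let M : Set (ProbabilityMeasure (Θ × (G → S))) := 
    {μ | (μ : Measure (Θ × (G → S))).map Prod.fst = ν}
  have htight : IsTightMeasureSet
      {((μ : ProbabilityMeasure (Θ × (G → S))) : Measure (Θ × (G → S))) | μ ∈ M} := by
    rw [isTightMeasureSet_iff_exists_isCompact_measure_compl_le]
    intro ε hε
    obtain ⟨K, hK, hKε⟩ := isTightMeasureSet_iff_exists_isCompact_measure_compl_le.1
      (isTightMeasureSet_singleton (μ := ν)) ε hε
    refine ⟨K ×ˢ Set.univ, hK.prod isCompact_univ, ?_⟩
    rintro _ ⟨μ, hμ, rfl⟩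
    have : (K ×ˢ Set.univ : Set (Θ × (G → S)))ᶜ = Prod.fst ⁻¹' Kᶜ := by ext; simp
    rw [this, ← Measure.map_apply measurable_fst hK.measurableSet.compl, show _ = ν from hμ]
    exact hKε ν rfl
  have hcomp := isCompact_closure_of_isTightMeasureSet htight
  let P : ι → ProbabilityMeasure (Θ × (G → S)) := fun i => ⟨μ i, hμ i⟩
  have hle : ((l.map P : Ultrafilter _) : Filter _) ≤ 𝓟 (closure M) := by
    rw [le_principal_iff]
    exact Filter.mem_map.2 (Filter.univ_mem' fun i => subset_closure (hμν i))
  obtain ⟨ρ, -, hρ⟩ := hcomp.ultrafilter_le_nhds _ hle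
  have hlim : Tendsto P l (𝓝 ρ) := hρ
  have hρν : (ρ : Measure (Θ × (G → S))).map Prod.fst = ν := by
    have h1 := ProbabilityMeasure.tendsto_map_of_tendsto_of_continuous P ρ hlim
      (continuous_fst (X := Θ) (Y := G → S))
    let N : ProbabilityMeasure Θ := ⟨ν, inferInstance⟩
    have h2 : Tendsto (fun i => (P i).map (continuous_fst (X := Θ) (Y := G → S)).aemeasurable) l (𝓝 N) :=
      tendsto_const_nhds.congr fun i => Subtype.ext (hμν i).symm
    have h3 := tendsto_nhds_unique h1 h2
    exact congrArg Subtype.val h3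
  refine ⟨ρ, inferInstance, hρν, fun h hh => ?_⟩
  rw [Metric.tendsto_nhds]
  intro ε hε
  obtain ⟨H, hH⟩ := exists_continuous_approx ν hh (ε := ε / 4) (by positivity)
  have hHlim := ProbabilityMeasure.tendsto_iff_forall_integral_tendsto.1 hlim H
  filter_upwards [Metric.tendsto_nhds.1 hHlim (ε / 4) (by positivity)] with i hi
  have h1 := abs_le.1 (hH (μ i) (hμ i) (hμν i))
  have h2 := abs_le.1 (hH ρ inferInstance hρν)
  rw [Real.dist_eq, abs_lt] at hi ⊢
  change _ < (∫ p, H p ∂(μ i)) - _ ∧ (∫ p, H p ∂(μ i)) - _ < _ at hi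
  constructor <;> linarith [hi.1, hi.2, h1.1, h1.2, h2.1, h2.2]

theorem UnifCont.tendsto_lintegral {ι : Type*} {l : Filter ι} {μ : ι → Measure (Θ × (G → S))}
    (hμ : ∀ i, IsProbabilityMeasure (μ i)) {ρ : Measure (Θ × (G → S))} [IsProbabilityMeasure ρ]
    (hlim : ∀ h, UnifCont h → Tendsto (fun i => ∫ p, h p ∂(μ i)) l (𝓝 (∫ p, h p ∂ρ)))
    {h : Θ × (G → S) → ℝ} (hh : UnifCont h) (h0 : ∀ p, 0 ≤ h p) :
    Tendsto (fun i => ∫⁻ p, ENNReal.ofReal (h p) ∂(μ i)) l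
      (𝓝 (∫⁻ p, ENNReal.ofReal (h p) ∂ρ)) := by
  have e : ∀ m : Measure (Θ × (G → S)), IsProbabilityMeasure m →
      ∫⁻ p, ENNReal.ofReal (h p) ∂m = ENNReal.ofReal (∫ p, h p ∂m) := fun m _ =>
    (ofReal_integral_eq_lintegral_ofReal (hh.integrable m) (ae_of_all _ h0)).symm
  rw [e ρ inferInstance]
  simp only [e _ (hμ _)]
  exact ENNReal.tendsto_ofReal (hlim h hh)

end Compactness

/-! ### Conditional energies -/

section Energy

/-- The action of `G` on `Θ × Σ^G`. -/
def actMap (R : RelSystem G S Θ) (g : G) (p : Θ × (G → S)) : Θ × (G → S) :=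
  (R.act g p.1, shift G S g p.2)

theorem actMap_mul (R : RelSystem G S Θ) (g h : G) (p : Θ × (G → S)) :
    actMap R (g * h) p = actMap R g (actMap R h p) := by
  refine Prod.ext (R.act_mul g h p.1) (funext fun k => ?_)
  simp [actMap, shift, mul_assoc]

theorem actMap_one (R : RelSystem G S Θ) (p : Θ × (G → S)) : actMap R 1 p = p :=
  Prod.ext (R.act_one p.1) (funext fun k => by simp [actMap, shift])

theorem actMap_inv_actMap (R : RelSystem G S Θ) (g : G) (p : Θ × (G → S)) :
    actMap R g⁻¹ (actMap R g p) = p := by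
  rw [← actMap_mul, inv_mul_cancel, actMap_one]

theorem measurable_actMap (R : RelSystem G S Θ) (g : G) : Measurable (actMap R g) :=
  ((R.act_measurable g).comp measurable_fst).prodMk
    (measurable_pi_lambda _ fun k => (measurable_pi_apply (g⁻¹ * k)).comp measurable_snd)

theorem UnifCont.comp_actMap {h : Θ × (G → S) → ℝ} (hh : UnifCont h) (R : RelSystem G S Θ)
    (g : G) : UnifCont fun p => h (actMap R g p) := by
  refine ⟨hh.measurable.comp (measurable_actMap R g), ?_, fun ε hε => ?_⟩
  · exact hh.bounded.imp fun c hc p => hc _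
  · obtain ⟨B, hB⟩ := hh.local_approx ε hε
    refine ⟨B.image (g⁻¹ * ·), fun θ x y hxy => hB _ _ _ fun a ha => ?_⟩
    exact hxy _ (Finset.mem_image_of_mem _ ha)

theorem mem_Omega_actMap (R : RelSystem G S Θ) (g : G) (p : Θ × (G → S)) :
    actMap R g p ∈ R.Omega ↔ p ∈ R.Omega := by
  have key : ∀ (g : G) (p : Θ × (G → S)), p ∈ R.Omega → actMap R g p ∈ R.Omega := by
    intro g p hp
    change shift G S g p.2 ∈ R.X (R.act g p.1)
    rw [R.X_equivariant]
    exact Set.mem_image_of_mem _ hp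
  refine ⟨fun h => ?_, key g p⟩
  have := key g⁻¹ _ h
  rwa [actMap_inv_actMap] at this

theorem actMap_glueMap (R : RelSystem G S Θ) (g : G) (A : Finset G) (z : G → S)
    (p : Θ × (G → S)) :
    actMap R g (glueMap A z p) =
      glueMap (A.image (g * ·)) (shift G S g z) (actMap R g p) := by
  refine Prod.ext rfl (funext fun k => ?_)
  have : k ∈ A.image (g * ·) ↔ g⁻¹ * k ∈ A := by
    simp only [Finset.mem_image]
    exact ⟨by rintro ⟨a, ha, rfl⟩; simpa using ha, fun h => ⟨_, h, by simp⟩⟩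
  simp only [actMap, glueMap, glue, shift, this]

theorem image_mul_left_inv (g : G) (C : Finset G) :
    (C.image (g⁻¹ * ·)).image (g * ·) = C := by
  rw [Finset.image_image]
  simp [Function.comp_def]

/-- Left translation of finite subsets of `G`. -/
def translate (g : G) : Finset G ≃ Finset G where
  toFun C := C.image (g * ·)
  invFun C := C.image (g⁻¹ * ·)
  left_inv C := by simpa using image_mul_left_inv g⁻¹ C
  right_inv C := image_mul_left_inv g C

theorem inter_translate_nonempty (g : G) (A C : Finset G) :
    (C.image (g * ·) ∩ A.image (g * ·)).Nonempty ↔ (C ∩ A).Nonempty := by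
  rw [← Finset.image_inter _ _ (mul_right_injective g), Finset.image_nonempty]

variable (Φ : Interaction G S Θ R)

theorem Interaction.Phi_local (C : Finset G) (θ : Θ) {x y : G → S} (hxy : ∀ a ∈ C, x a = y a) :
    Φ.Phi C (θ, x) = Φ.Phi C (θ, y) := by
  let r : Θ × (G → S) → Θ × ((C : Set G).Elem → S) := fun p => (p.1, fun b => p.2 b)
  have hle : FTheta ⊔ xi (C : Set G) ≤ MeasurableSpace.comap r inferInstance := by
    refine sup_le ?_ ?_
    · rintro _ ⟨E, hE, rfl⟩
      exact ⟨Prod.fst ⁻¹' E, measurable_fst hE, rfl⟩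
    · rintro _ ⟨E, hE, rfl⟩
      exact ⟨Prod.snd ⁻¹' E, measurable_snd hE, rfl⟩
  obtain ⟨t, -, ht⟩ := hle _ (Φ.measurable' C (measurableSet_singleton (Φ.Phi C (θ, x))))
  have hr : r (θ, y) = r (θ, x) := Prod.ext rfl (funext fun b => (hxy b b.2).symm)
  have hx : (θ, x) ∈ r ⁻¹' t := by rw [ht]; rfl
  have hy : (θ, y) ∈ r ⁻¹' t := by rw [Set.mem_preimage, hr]; exact hx
  rw [ht] at hy
  exact (show Φ.Phi C (θ, y) = Φ.Phi C (θ, x) from hy).symm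

theorem Interaction.measurable_Phi (C : Finset G) : Measurable (Φ.Phi C) := by
  refine (Φ.measurable' C).mono (sup_le ?_ ?_) le_rfl
  · exact measurable_fst.comap_le
  · refine Measurable.comap_le ?_
    fun_prop

theorem Interaction.abs_Phi_le (C : Finset G) (p : Θ × (G → S)) :
    |Φ.Phi C p| ≤ supAbs (Φ.Phi C) := by
  obtain ⟨c, hc⟩ := Φ.bounded' C
  exact le_ciSup (f := fun p => |Φ.Phi C p|) ⟨c, by rintro _ ⟨p, rfl⟩; exact hc p⟩ p

theorem supAbs_nonneg {α : Type} (f : α → ℝ) : 0 ≤ supAbs f :=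
  Real.iSup_nonneg fun _ => abs_nonneg _

theorem Interaction.Phi_translate (g : G) (C : Finset G) (p : Θ × (G → S)) :
    Φ.Phi (C.image (g * ·)) (actMap R g p) = Φ.Phi C p := by
  rw [Φ.equivariant' g C]
  exact congrArg (Φ.Phi C) (actMap_inv_actMap R g p)

theorem Interaction.supAbs_translate (g : G) (C : Finset G) :
    supAbs (Φ.Phi (C.image (g * ·))) = supAbs (Φ.Phi C) := by
  have hs : Function.Surjective (actMap R g) := fun p =>
    ⟨actMap R g⁻¹ p, by simpa using actMap_inv_actMap R g⁻¹ p⟩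
  unfold supAbs
  rw [← hs.iSup_comp]
  simp only [Φ.Phi_translate]

variable {Φ}

theorem Interaction.AbsSummable.summable_inter (hΦ : Φ.AbsSummable) (A : Finset G) :
    Summable fun C : Finset G => if (C ∩ A).Nonempty then supAbs (Φ.Phi C) else 0 := by
  have h1 : ∀ a : G, Summable fun C : Finset G => if a ∈ C then supAbs (Φ.Phi C) else 0 := by
    intro a
    rw [← (translate a).summable_iff]
    refine hΦ.congr fun C => ?_
    have : a ∈ C.image (a * ·) ↔ (1 : G) ∈ C := by simp
    simp only [Function.comp_apply, translate, Equiv.coe_fn_mk, this, Φ.supAbs_translate]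
  refine Summable.of_nonneg_of_le (fun C => ?_) (fun C => ?_)
    (summable_sum (s := A) fun a _ => h1 a)
  · split_ifs
    exacts [supAbs_nonneg _, le_rfl]
  · have h0 : ∀ a ∈ A, 0 ≤ if a ∈ C then supAbs (Φ.Phi C) else 0 := fun a _ => by
      split_ifs
      exacts [supAbs_nonneg _, le_rfl]
    split_ifs with h
    · obtain ⟨a, ha⟩ := h
      rw [Finset.mem_inter] at ha
      exact (le_of_eq (if_pos ha.1).symm).trans (Finset.single_le_sum h0 ha.2)
    · exact Finset.sum_nonneg h0

theorem abs_condEnergy_term_le (A C : Finset G) (p : Θ × (G → S)) :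
    |if (C ∩ A).Nonempty then Φ.Phi C p else 0| ≤
      if (C ∩ A).Nonempty then supAbs (Φ.Phi C) else 0 := by
  split_ifs
  · exact Φ.abs_Phi_le C p
  · simp

theorem summable_condEnergy (hΦ : Φ.AbsSummable) (A : Finset G) (p : Θ × (G → S)) :
    Summable fun C : Finset G => if (C ∩ A).Nonempty then Φ.Phi C p else 0 :=
  .of_norm_bounded (hΦ.summable_inter A) fun C => abs_condEnergy_term_le A C p

theorem unifCont_condEnergy (hΦ : Φ.AbsSummable) (A : Finset G) : UnifCont (condEnergy Φ A) := by
  refine ⟨?_, ⟨∑' C : Finset G, if (C ∩ A).Nonempty then supAbs (Φ.Phi C) else 0, fun p => ?_⟩,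
    fun ε hε => ?_⟩
  · refine Measurable.tsum fun C => ?_
    split_ifs
    exacts [Φ.measurable_Phi C, measurable_const]
  · exact tsum_of_norm_bounded (f := fun C => if (C ∩ A).Nonempty then Φ.Phi C p else 0)
      (hΦ.summable_inter A).hasSum fun C => abs_condEnergy_term_le A C p
  · have hu := tendstoUniformly_tsum (f := fun (C : Finset G) (p : Θ × (G → S)) =>
      if (C ∩ A).Nonempty then Φ.Phi C p else 0) (hΦ.summable_inter A)
      fun C p => abs_condEnergy_term_le A C p
    obtain ⟨T, hT⟩ := (Metric.tendstoUniformly_iff.1 hu (ε / 2) (by positivity)).exists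
    refine ⟨T.biUnion id, fun θ x y hxy => ?_⟩
    have hxT := hT (θ, x)
    have hyT := hT (θ, y)
    have e : (∑ C ∈ T, if (C ∩ A).Nonempty then Φ.Phi C (θ, x) else 0) =
        ∑ C ∈ T, if (C ∩ A).Nonempty then Φ.Phi C (θ, y) else 0 := by
      refine Finset.sum_congr rfl fun C hC => ?_
      rw [Φ.Phi_local C θ fun a ha => hxy a (Finset.mem_biUnion.2 ⟨C, hC, ha⟩)]
    rw [e] at hxT
    have := (dist_triangle_right _ _ _).trans (add_le_add hxT.le hyT.le)
    rw [Real.dist_eq, add_halves] at this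
    exact this

theorem condEnergy_sub_of_subset (hΦ : Φ.AbsSummable) {A B : Finset G} (hAB : A ⊆ B) (θ : Θ)
    {x y : G → S} (hxy : ∀ k ∉ A, x k = y k) :
    condEnergy Φ B (θ, x) - condEnergy Φ B (θ, y) =
      condEnergy Φ A (θ, x) - condEnergy Φ A (θ, y) := by
  unfold condEnergy
  rw [← (summable_condEnergy hΦ B _).tsum_sub (summable_condEnergy hΦ B _),
    ← (summable_condEnergy hΦ A _).tsum_sub (summable_condEnergy hΦ A _)]
  refine tsum_congr fun C => ?_
  by_cases hA : (C ∩ A).Nonempty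
  · have hB : (C ∩ B).Nonempty := hA.mono (Finset.inter_subset_inter_left hAB)
    simp only [hA, hB, if_true]
  · have e : Φ.Phi C (θ, x) = Φ.Phi C (θ, y) := Φ.Phi_local C θ fun a ha =>
      hxy a fun haA => hA ⟨a, Finset.mem_inter.2 ⟨ha, haA⟩⟩
    simp only [hA, if_false, e, sub_self]

theorem condEnergy_translate (g : G) (A : Finset G) (p : Θ × (G → S)) :
    condEnergy Φ (A.image (g * ·)) (actMap R g p) = condEnergy Φ A p := by
  unfold condEnergy
  rw [← (translate g).tsum_eq]
  refine tsum_congr fun C => ?_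
  simp only [translate, Equiv.coe_fn_mk, inter_translate_nonempty, Φ.Phi_translate]

end Energy

/-! ### Admissible patterns -/

section Patterns

/-- The environments for which the pattern of `y` on `A` extends to an admissible
configuration. -/
def extensible (R : RelSystem G S Θ) (A : Finset G) (y : G → S) : Set Θ :=
  {θ | ∃ x ∈ R.X θ, ∀ a ∈ A, x a = y a}

theorem extensible_congr (R : RelSystem G S Θ) {A : Finset G} {y z : G → S}
    (h : ∀ a ∈ A, y a = z a) : extensible R A y = extensible R A z := by
  ext θ
  refine exists_congr fun x => and_congr_right fun _ => forall₂_congr fun a ha => ?_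
  rw [h a ha]

theorem extensible_anti (R : RelSystem G S Θ) {A B : Finset G} (h : A ⊆ B) (y : G → S) :
    extensible R B y ⊆ extensible R A y :=
  fun _ ⟨x, hx, hxy⟩ => ⟨x, hx, fun a ha => hxy a (h ha)⟩

theorem nullMeasurableSet_extensible [StandardBorelSpace Θ] (R : RelSystem G S Θ)
    (ν : Measure Θ) [IsFiniteMeasure ν] (A : Finset G) (y : G → S) :
    NullMeasurableSet (extensible R A y) ν := by
  let _ := upgradeStandardBorel Θ
  have : BorelSpace S := ⟨by
    rw [borel_eq_top_of_discrete]
    exact eq_top_iff.2 fun s _ => s.toFinite.measurableSet⟩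
  have hD : MeasurableSet (R.Omega ∩ {p | ∀ a ∈ A, p.2 a = y a}) := by
    refine R.omega_measurable.inter ?_
    have : {p : Θ × (G → S) | ∀ a ∈ A, p.2 a = y a} =
        ⋂ a ∈ A, (fun p : Θ × (G → S) => p.2 a) ⁻¹' {y a} := by ext; simp
    rw [this]
    exact Finset.measurableSet_biInter A fun a _ =>
      ((measurable_pi_apply a).comp measurable_snd) (measurableSet_singleton _)
  have he : extensible R A y = Prod.fst '' (R.Omega ∩ {p | ∀ a ∈ A, p.2 a = y a}) := by
    ext θ
    constructor
    · rintro ⟨x, hx, hxy⟩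
      exact ⟨(θ, x), ⟨hx, hxy⟩, rfl⟩
    · rintro ⟨p, ⟨hp, hpy⟩, rfl⟩
      exact ⟨p.2, hp, hpy⟩
  rw [he]
  have : PolishSpace Θ := inferInstance
  have : PolishSpace S := inferInstance
  have : PolishSpace (G → S) := inferInstance
  have : PolishSpace (Θ × (G → S)) := inferInstance
  exact nullMeasurableSet_of_analyticSet ν (hD.analyticSet.image_of_continuous continuous_fst)

/-- A measurable version of `extensible`. -/
def extensibleVersion (R : RelSystem G S Θ) (ν : Measure Θ) (A : Finset G) (y : G → S) : Set Θ :=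
  toMeasurable ν (extensible R A y)

theorem extensibleVersion_congr (R : RelSystem G S Θ) (ν : Measure Θ) {A : Finset G}
    {y z : G → S} (h : ∀ a ∈ A, y a = z a) :
    extensibleVersion R ν A y = extensibleVersion R ν A z := by
  rw [extensibleVersion, extensible_congr R h, extensibleVersion]

theorem ae_mem_extensibleVersion_iff [StandardBorelSpace Θ] (R : RelSystem G S Θ)
    (ν : Measure Θ) [IsFiniteMeasure ν] :
    ∀ᵐ θ ∂ν, ∀ A y, θ ∈ extensibleVersion R ν A y ↔ θ ∈ extensible R A y := by
  have h : ∀ᵐ θ ∂ν, ∀ (A : Finset G) (u : A → S),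
      θ ∈ extensibleVersion R ν A (extend A u) ↔ θ ∈ extensible R A (extend A u) := by
    rw [ae_all_iff]
    intro A
    rw [ae_all_iff]
    intro u
    exact (nullMeasurableSet_extensible R ν A (extend A u)).toMeasurable_ae_eq.mem_iff
  filter_upwards [h] with θ hθ A y
  have e := extend_restrict (A := A) y
  rw [← extensibleVersion_congr R ν e, ← extensible_congr R e]
  exact hθ A _

theorem mem_X_of_forall_extensible (R : RelSystem G S Θ) {θ : Θ} {x : G → S}
    (h : ∀ A, θ ∈ extensible R A x) : x ∈ R.X θ := by
  rw [← (R.X_closed θ).closure_eq, mem_closure_iff]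
  intro U hU hxU
  obtain ⟨A, u, hu, hAU⟩ := isOpen_pi_iff.1 hU x hxU
  obtain ⟨y, hy, hyx⟩ := h A
  refine ⟨y, hAU fun a ha => ?_, hy⟩
  rw [hyx a ha]
  exact (hu a ha).2

theorem unifCont_extensibleVersion_glue (R : RelSystem G S Θ) (ν : Measure Θ) (A B : Finset G)
    (z : G → S) :
    UnifCont ({p : Θ × (G → S) | p.1 ∈ extensibleVersion R ν B (glue A z p.2)}.indicator
      fun _ => (1 : ℝ)) := by
  refine .indicator_of_local B
    (fun x => measurableSet_toMeasurable ν (extensible R B (glue A z x))) fun θ x y hxy => ?_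
  have : extensibleVersion R ν B (glue A z x) = extensibleVersion R ν B (glue A z y) :=
    extensibleVersion_congr R ν fun a ha => by simp only [glue, hxy a ha]
  change θ ∈ extensibleVersion R ν B (glue A z x) ↔ θ ∈ extensibleVersion R ν B (glue A z y)
  rw [this]

theorem glue_empty (z x : G → S) : glue ∅ z x = x := by
  ext k; simp [glue]

theorem unifCont_extensibleVersion (R : RelSystem G S Θ) (ν : Measure Θ) (A : Finset G) :
    UnifCont ({p : Θ × (G → S) | p.1 ∈ extensibleVersion R ν A p.2}.indicator
      fun _ => (1 : ℝ)) := by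
  simpa only [glue_empty] using
    unifCont_extensibleVersion_glue R ν ∅ A (fun _ => Classical.arbitrary S)

theorem measurableSet_extensibleVersion (R : RelSystem G S Θ) (ν : Measure Θ) (A : Finset G) :
    MeasurableSet {p : Θ × (G → S) | p.1 ∈ extensibleVersion R ν A p.2} := by
  convert (unifCont_extensibleVersion R ν A).measurable (measurableSet_singleton 1) using 1
  ext p
  simp

/-- Limits of measures that asymptotically charge only admissible patterns live on `Ω`. -/
theorem ae_mem_Omega_of_tendsto [StandardBorelSpace Θ] (R : RelSystem G S Θ) (ν : Measure Θ)
    [IsFiniteMeasure ν] {ι : Type*} {l : Filter ι} [l.NeBot] {μ : ι → Measure (Θ × (G → S))}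
    (hμ : ∀ i, IsProbabilityMeasure (μ i)) {ρ : Measure (Θ × (G → S))} [IsProbabilityMeasure ρ]
    (hρν : ρ.map Prod.fst = ν)
    (hlim : ∀ h, UnifCont h → Tendsto (fun i => ∫ p, h p ∂(μ i)) l (𝓝 (∫ p, h p ∂ρ)))
    (hext : ∀ A, ∀ᶠ i in l, ∀ᵐ p ∂(μ i), p.1 ∈ extensibleVersion R ν A p.2) :
    ∀ᵐ p ∂ρ, p ∈ R.Omega := by
  have h1 : ∀ᵐ p ∂ρ, ∀ A, p.1 ∈ extensibleVersion R ν A p.2 := by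
    rw [ae_all_iff]
    intro A
    have huc := unifCont_extensibleVersion R ν A
    have hl : Tendsto (fun _ : ι => (1 : ℝ)) l (𝓝 (∫ p,
        {p : Θ × (G → S) | p.1 ∈ extensibleVersion R ν A p.2}.indicator (fun _ => (1 : ℝ)) p
          ∂ρ)) := by
      refine (hlim _ huc).congr' ?_
      filter_upwards [hext A] with i hi
      have : ∀ᵐ p ∂(μ i), {p : Θ × (G → S) | p.1 ∈ extensibleVersion R ν A p.2}.indicator
          (fun _ => (1 : ℝ)) p = 1 := by
        filter_upwards [hi] with p hp
        exact Set.indicator_of_mem (s := {p : Θ × (G → S) | p.1 ∈ extensibleVersion R ν A p.2})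
          hp _
      rw [integral_congr_ae this]
      simp
    have hD := measurableSet_extensibleVersion R ν A
    have := tendsto_nhds_unique hl tendsto_const_nhds
    rw [integral_indicator_const _ hD, smul_eq_mul, mul_one] at this
    rw [measureReal_def, ENNReal.toReal_eq_one_iff] at this
    exact (prob_compl_eq_zero_iff hD).2 this
  have h2 : ∀ᵐ p ∂ρ, ∀ A y, p.1 ∈ extensibleVersion R ν A y ↔ p.1 ∈ extensible R A y := by
    have := ae_mem_extensibleVersion_iff R ν
    rw [← hρν] at this ⊢
    exact ae_of_ae_map measurable_fst.aemeasurable this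
  filter_upwards [h1, h2] with p hp1 hp2
  exact mem_X_of_forall_extensible R fun A => (hp2 A p.2).1 (hp1 A)

theorem ae_mem_extensibleVersion_of_Omega [StandardBorelSpace Θ] (R : RelSystem G S Θ)
    (ν : Measure Θ) {μ : Measure (Θ × (G → S))} (hμ : ∀ᵐ p ∂μ, p ∈ R.Omega) (A : Finset G) :
    ∀ᵐ p ∂μ, p.1 ∈ extensibleVersion R ν A p.2 := by
  filter_upwards [hμ] with p hp
  exact subset_toMeasurable _ _ ⟨p.2, hp, fun _ _ => rfl⟩

/-- A measurable choice of patterns on `A` that are admissible for almost every environment. -/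
theorem exists_measurable_extensible [StandardBorelSpace Θ] (R : RelSystem G S Θ)
    (hfibers : ∀ θ, (R.X θ).Nonempty) (ν : Measure Θ) (A : Finset G) :
    ∃ s : Θ → (G → S), Measurable s ∧ ∀ θ, θ ∈ extensibleVersion R ν A (s θ) := by
  classical
  have : Encodable (A → S) := Fintype.toEncodable _
  let q : Θ → ℕ → Prop := fun θ k =>
    ∃ u ∈ Encodable.decode (α := A → S) k, θ ∈ extensibleVersion R ν A (extend A u)
  have hq : ∀ θ, ∃ k, q θ k := by
    intro θ
    obtain ⟨x, hx⟩ := hfibers θ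
    refine ⟨Encodable.encode fun a : A => x a, fun a : A => x a, Encodable.encodek _, ?_⟩
    exact subset_toMeasurable _ _ ⟨x, hx, fun a ha => (extend_restrict x a ha).symm⟩
  have hm : Measurable fun θ => Nat.find (hq θ) := by
    refine measurable_find hq fun k => ?_
    have : {θ | q θ k} = ⋃ (u : A → S) (_ : u ∈ Encodable.decode (α := A → S) k),
        extensibleVersion R ν A (extend A u) := by
      ext θ; simp [q]
    rw [this]
    exact MeasurableSet.iUnion fun u => MeasurableSet.iUnion fun _ => measurableSet_toMeasurable _ _
  let d : ℕ → (G → S) := fun k =>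
    (Encodable.decode (α := A → S) k).elim (fun _ => Classical.arbitrary S) (extend A)
  refine ⟨fun θ => d (Nat.find (hq θ)), (measurable_from_nat (f := d)).comp hm, fun θ => ?_⟩
  obtain ⟨u, hu, hθ⟩ := Nat.find_spec (hq θ)
  simp only [d, Option.mem_def.1 hu, Option.elim]
  exact hθ

/-- There is a measure on `Ω` with any prescribed marginal. -/
theorem exists_measure_Omega [StandardBorelSpace Θ] (R : RelSystem G S Θ)
    (hfibers : ∀ θ, (R.X θ).Nonempty) (ν : Measure Θ) [IsProbabilityMeasure ν] :
    ∃ μ : Measure (Θ × (G → S)), IsProbabilityMeasure μ ∧ μ.map Prod.fst = ν ∧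
      ∀ᵐ p ∂μ, p ∈ R.Omega := by
  choose s hs hsm using exists_measurable_extensible R hfibers ν
  have hm : ∀ A, Measurable fun θ => (θ, s A θ) := fun A => measurable_id.prodMk (hs A)
  have hprob : ∀ A, IsProbabilityMeasure (ν.map fun θ => (θ, s A θ)) := fun A =>
    Measure.isProbabilityMeasure_map (hm A).aemeasurable
  obtain ⟨μ, hμ, hμν, hlim⟩ := exists_ultrafilter_limit ν (Ultrafilter.of atTop)
    (fun A => ν.map fun θ => (θ, s A θ)) hprob fun A => by
      rw [Measure.map_map measurable_fst (hm A)]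
      exact Measure.map_id
  refine ⟨μ, hμ, hμν, ae_mem_Omega_of_tendsto R ν hprob hμν hlim fun A => ?_⟩
  filter_upwards [Ultrafilter.of_le atTop (eventually_ge_atTop A)] with B hB
  have h2 : ∀ᵐ p ∂(ν.map fun θ => (θ, s B θ)),
      ∀ A y, p.1 ∈ extensibleVersion R ν A y ↔ p.1 ∈ extensible R A y := by
    have hfst : (ν.map fun θ => (θ, s B θ)).map Prod.fst = ν := by
      rw [Measure.map_map measurable_fst (hm B)]
      exact Measure.map_id
    have := ae_mem_extensibleVersion_iff R ν
    rw [← hfst] at this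
    have := ae_of_ae_map measurable_fst.aemeasurable this
    rwa [hfst] at this
  have h1 : ∀ᵐ p ∂(ν.map fun θ => (θ, s B θ)), p.1 ∈ extensibleVersion R ν B p.2 := by
    rw [ae_map_iff (hm B).aemeasurable (measurableSet_extensibleVersion R ν B)]
    exact ae_of_all _ fun θ => hsm B θ
  filter_upwards [h1, h2] with p hp1 hp2
  exact (hp2 A p.2).2 (extensible_anti R hB p.2 ((hp2 B p.2).1 hp1))

end Patterns

/-! ### Gibbs weights and detailed balance -/

section DetailedBalance

/-- The unnormalized Gibbs weight, extended by zero outside `Ω`. -/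
def weight (Φ : Interaction G S Θ R) (A : Finset G) : Θ × (G → S) → ℝ≥0∞ :=
  R.Omega.indicator fun p => ENNReal.ofReal (Real.exp (-(condEnergy Φ A p)))

/-- The indicator function of the configurations that agree with `y` on `A`. -/
def agreeInd (A : Finset G) (y : G → S) : Θ × (G → S) → ℝ≥0∞ :=
  Set.indicator {p | ∀ a ∈ A, p.2 a = y a} 1

theorem agreeInd_of_agree {A : Finset G} {y : G → S} {p : Θ × (G → S)}
    (h : ∀ a ∈ A, p.2 a = y a) : agreeInd A y p = 1 :=
  Set.indicator_of_mem (s := {p : Θ × (G → S) | ∀ a ∈ A, p.2 a = y a}) h 1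

theorem agreeInd_of_not_agree {A : Finset G} {y : G → S} {p : Θ × (G → S)}
    (h : ¬∀ a ∈ A, p.2 a = y a) : agreeInd A y p = 0 :=
  Set.indicator_of_notMem (s := {p : Θ × (G → S) | ∀ a ∈ A, p.2 a = y a}) h 1

theorem glueMap_glueMap (A : Finset G) (y z : G → S) (p : Θ × (G → S)) :
    glueMap A y (glueMap A z p) = glueMap A y p := by
  refine Prod.ext rfl (funext fun k => ?_)
  by_cases hk : k ∈ A <;> simp [glueMap, glue, hk]

theorem glueMap_eq_self {A : Finset G} {y : G → S} {p : Θ × (G → S)}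
    (h : ∀ a ∈ A, p.2 a = y a) : glueMap A y p = p := by
  refine Prod.ext rfl (funext fun k => ?_)
  by_cases hk : k ∈ A
  · simp [glueMap, glue, hk, h k hk]
  · simp [glueMap, glue, hk]

theorem measurableSet_agree (A : Finset G) (y : G → S) :
    MeasurableSet {p : Θ × (G → S) | ∀ a ∈ A, p.2 a = y a} := by
  have : {p : Θ × (G → S) | ∀ a ∈ A, p.2 a = y a} =
      ⋂ a ∈ A, (fun p : Θ × (G → S) => p.2 a) ⁻¹' {y a} := by ext; simp
  rw [this]
  exact Finset.measurableSet_biInter A fun a _ =>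
    ((measurable_pi_apply a).comp measurable_snd) (measurableSet_singleton _)

theorem measurable_agreeInd (A : Finset G) (y : G → S) :
    Measurable (agreeInd (Θ := Θ) A y) :=
  measurable_one.indicator (measurableSet_agree A y)

theorem sum_agreeInd (A : Finset G) (p : Θ × (G → S)) :
    ∑ u : A → S, agreeInd A (extend A u) p = 1 := by
  rw [Finset.sum_eq_single fun a : A => p.2 a]
  · exact agreeInd_of_agree fun a ha => (extend_restrict p.2 a ha).symm
  · intro u _ hu
    refine agreeInd_of_not_agree fun h => hu (funext fun a => ?_)
    rw [h a a.2, extend_apply_mem u a.2]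
  · simp

variable {Φ : Interaction G S Θ R}

theorem measurable_weight (hΦ : Φ.AbsSummable) (A : Finset G) : Measurable (weight Φ A) :=
  (unifCont_condEnergy hΦ A).exp_neg.measurable.ennreal_ofReal.indicator R.omega_measurable

theorem weight_le (hΦ : Φ.AbsSummable) (A : Finset G) :
    ∃ c : ℝ, ∀ p, weight Φ A p ≤ ENNReal.ofReal c := by
  obtain ⟨c, hc⟩ := (unifCont_condEnergy hΦ A).exp_neg.bounded
  refine ⟨c, fun p => ?_⟩
  refine (Set.indicator_le_self' (fun _ _ => zero_le) p).trans ?_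
  exact ENNReal.ofReal_le_ofReal ((le_abs_self _).trans (hc p))

theorem weight_mul_weight_comm (hΦ : Φ.AbsSummable) {A B : Finset G} (hAB : A ⊆ B)
    {p q : Θ × (G → S)} (h1 : p.1 = q.1) (h2 : ∀ k ∉ A, p.2 k = q.2 k) :
    weight Φ B p * weight Φ A q = weight Φ B q * weight Φ A p := by
  by_cases hp : p ∈ R.Omega
  swap
  · simp [weight, hp]
  by_cases hq : q ∈ R.Omega
  swap
  · simp [weight, hq]
  simp only [weight, Set.indicator_of_mem hp, Set.indicator_of_mem hq]
  rw [← ENNReal.ofReal_mul (Real.exp_pos _).le, ← ENNReal.ofReal_mul (Real.exp_pos _).le,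
    ← Real.exp_add, ← Real.exp_add]
  obtain ⟨θ, x⟩ := p
  obtain ⟨θ', y⟩ := q
  obtain rfl : θ = θ' := h1
  have := condEnergy_sub_of_subset hΦ hAB θ h2
  congr 2
  linarith

/-- The partition function, as an extended nonnegative real. -/
def partitionSum (Φ : Interaction G S Θ R) (A : Finset G) (p : Θ × (G → S)) : ℝ≥0∞ :=
  ∑ u : A → S, weight Φ A (glueMap A (extend A u) p)

theorem measurable_partitionSum (hΦ : Φ.AbsSummable) (A : Finset G) :
    Measurable (partitionSum Φ A) :=
  Finset.measurable_sum _ fun u _ =>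
    (measurable_weight hΦ A).comp (measurable_glueMap A (extend A u))

theorem partitionSum_glueMap (A : Finset G) (z : G → S) (p : Θ × (G → S)) :
    partitionSum Φ A (glueMap A z p) = partitionSum Φ A p := by
  simp only [partitionSum, glueMap_glueMap]

theorem partitionSum_ne_top (A : Finset G) (p : Θ × (G → S)) : partitionSum Φ A p ≠ ∞ := by
  refine ENNReal.sum_ne_top.2 fun u _ => ?_
  by_cases h : glueMap A (extend A u) p ∈ R.Omega <;> simp [weight, h]

theorem partitionSum_ne_zero (A : Finset G) {p : Θ × (G → S)} (hp : p ∈ R.Omega) :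
    partitionSum Φ A p ≠ 0 := by
  intro h
  have := (Finset.sum_eq_zero_iff.1 h) (fun a => p.2 a) (Finset.mem_univ _)
  rw [glueMap_eq_self fun a ha => (extend_restrict p.2 a ha).symm, weight,
    Set.indicator_of_mem hp, ENNReal.ofReal_eq_zero] at this
  exact absurd (Real.exp_pos _) this.not_gt

theorem partitionSum_eq_ofReal (A : Finset G) (p : Θ × (G → S)) :
    partitionSum Φ A p = ENNReal.ofReal (partitionZ Φ A p) := by
  rw [partitionZ, ENNReal.ofReal_sum_of_nonneg]
  · refine Finset.sum_congr rfl fun u _ => ?_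
    rw [mergePat_eq_glue]
    by_cases h : glue A (extend A u) p.2 ∈ R.X p.1
    · have h' : glueMap A (extend A u) p ∈ R.Omega := h
      rw [if_pos h, weight, Set.indicator_of_mem h']
      rfl
    · have h' : glueMap A (extend A u) p ∉ R.Omega := h
      rw [if_neg h, weight, Set.indicator_of_notMem h', ENNReal.ofReal_zero]
  · intro u _
    split_ifs
    exacts [(Real.exp_pos _).le, le_rfl]

theorem gibbsKernel_eq (A : Finset G) (p : Θ × (G → S)) :
    gibbsKernel Φ A p = ∑ u : A → S,
      (weight Φ A (glueMap A (extend A u) p) / partitionSum Φ A p) •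
        Measure.dirac (glueMap A (extend A u) p) := by
  refine Finset.sum_congr rfl fun u _ => ?_
  rw [mergePat_eq_glue]
  by_cases h : glue A (extend A u) p.2 ∈ R.X p.1
  · have h' : glueMap A (extend A u) p ∈ R.Omega := h
    have hw : weight Φ A (glueMap A (extend A u) p) =
        ENNReal.ofReal (Real.exp (-(condEnergy Φ A (glueMap A (extend A u) p)))) :=
      Set.indicator_of_mem h' _
    have hZ : 0 < partitionZ Φ A p := by
      rw [← ENNReal.ofReal_pos, ← partitionSum_eq_ofReal, ← partitionSum_glueMap A (extend A u)]
      exact (partitionSum_ne_zero A h').bot_lt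
    rw [if_pos h, hw, partitionSum_eq_ofReal, ← ENNReal.ofReal_div_of_pos hZ]
    rfl
  · have h' : glueMap A (extend A u) p ∉ R.Omega := h
    rw [if_neg h, weight, Set.indicator_of_notMem h', ENNReal.zero_div, zero_smul]

theorem lintegral_gibbsKernel (A : Finset G) (p : Θ × (G → S)) {f : Θ × (G → S) → ℝ≥0∞}
    (hf : Measurable f) :
    ∫⁻ q, f q ∂(gibbsKernel Φ A p) = ∑ u : A → S,
      weight Φ A (glueMap A (extend A u) p) / partitionSum Φ A p *
        f (glueMap A (extend A u) p) := by
  rw [gibbsKernel_eq, lintegral_finsetSum_measure]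
  refine Finset.sum_congr rfl fun u _ => ?_
  rw [lintegral_smul_measure, lintegral_dirac' _ hf, smul_eq_mul]

theorem measurable_gibbsKernel (hΦ : Φ.AbsSummable) (A : Finset G) :
    Measurable (gibbsKernel Φ A) := by
  refine Measure.measurable_of_measurable_coe _ fun D hD => ?_
  have : (fun p => gibbsKernel Φ A p D) = fun p => ∑ u : A → S,
      weight Φ A (glueMap A (extend A u) p) / partitionSum Φ A p *
        D.indicator 1 (glueMap A (extend A u) p) := by
    ext p
    rw [← lintegral_gibbsKernel A p (measurable_one.indicator hD), lintegral_indicator_one hD]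
  rw [this]
  refine Finset.measurable_sum _ fun u _ => Measurable.mul (Measurable.div ?_ ?_) ?_
  · exact (measurable_weight hΦ A).comp (measurable_glueMap A _)
  · exact measurable_partitionSum hΦ A
  · exact (measurable_one.indicator hD).comp (measurable_glueMap A _)

/-- Detailed balance on `A`: resampling the pattern on `A` from `y` to `z` with the Gibbs weight
of the result is symmetric in `y` and `z`. -/
def DetailedBalance (Φ : Interaction G S Θ R) (μ : Measure (Θ × (G → S))) (A : Finset G) : Prop :=
  ∀ (y z : G → S) (F : Θ × (G → S) → ℝ≥0∞), Measurable F →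
    ∫⁻ p, agreeInd A y p * weight Φ A (glueMap A z p) * F (glueMap A z p) ∂μ =
      ∫⁻ p, agreeInd A z p * weight Φ A (glueMap A y p) * F (glueMap A z p) ∂μ

theorem measurable_balance_integrand (hΦ : Φ.AbsSummable) (A : Finset G) (y z z' : G → S)
    {F : Θ × (G → S) → ℝ≥0∞} (hF : Measurable F) : Measurable fun p =>
      agreeInd A y p * weight Φ A (glueMap A z p) * F (glueMap A z' p) :=
  ((measurable_agreeInd A y).mul ((measurable_weight hΦ A).comp (measurable_glueMap A z))).mul
    (hF.comp (measurable_glueMap A z'))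

theorem DetailedBalance.bind_gibbsKernel (hΦ : Φ.AbsSummable) {μ : Measure (Θ × (G → S))}
    {A : Finset G} (h : DetailedBalance Φ μ A) (hμ : ∀ᵐ p ∂μ, p ∈ R.Omega) :
    μ.bind (gibbsKernel Φ A) = μ := by
  ext D hD
  rw [Measure.bind_apply hD (measurable_gibbsKernel hΦ A).aemeasurable]
  have hD1 : Measurable (D.indicator (1 : Θ × (G → S) → ℝ≥0∞)) := measurable_one.indicator hD
  set F : Θ × (G → S) → ℝ≥0∞ := fun p => D.indicator 1 p / partitionSum Φ A p with hF
  have hFm : Measurable F := hD1.div (measurable_partitionSum hΦ A)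
  have key := fun y z z' : G → S => measurable_balance_integrand hΦ A y z z' hFm
  calc ∫⁻ p, gibbsKernel Φ A p D ∂μ
      = ∫⁻ p, ∑ v : A → S, ∑ u : A → S, agreeInd A (extend A u) p *
          weight Φ A (glueMap A (extend A v) p) * F (glueMap A (extend A v) p) ∂μ := by
        refine lintegral_congr fun p => ?_
        rw [← lintegral_indicator_one hD, lintegral_gibbsKernel A p hD1]
        refine Finset.sum_congr rfl fun v _ => ?_
        rw [← Finset.sum_mul, ← Finset.sum_mul, sum_agreeInd, one_mul, hF]
        simp only [partitionSum_glueMap, div_eq_mul_inv]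
        ring
    _ = ∑ v : A → S, ∑ u : A → S, ∫⁻ p, agreeInd A (extend A u) p *
          weight Φ A (glueMap A (extend A v) p) * F (glueMap A (extend A v) p) ∂μ := by
        rw [lintegral_finsetSum _ fun v _ => Finset.measurable_sum _ fun u _ => key _ _ _]
        exact Finset.sum_congr rfl fun v _ => lintegral_finsetSum _ fun u _ => key _ _ _
    _ = ∑ v : A → S, ∑ u : A → S, ∫⁻ p, agreeInd A (extend A v) p *
          weight Φ A (glueMap A (extend A u) p) * F (glueMap A (extend A v) p) ∂μ :=
        Finset.sum_congr rfl fun v _ => Finset.sum_congr rfl fun u _ => h _ _ F hFm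
    _ = ∫⁻ p, ∑ v : A → S, ∑ u : A → S, agreeInd A (extend A v) p *
          weight Φ A (glueMap A (extend A u) p) * F (glueMap A (extend A v) p) ∂μ := by
        rw [lintegral_finsetSum _ fun v _ => Finset.measurable_sum _ fun u _ => key _ _ _]
        exact Finset.sum_congr rfl fun v _ => (lintegral_finsetSum _ fun u _ => key _ _ _).symm
    _ = ∫⁻ p, D.indicator 1 p ∂μ := by
        refine lintegral_congr_ae ?_
        filter_upwards [hμ] with p hp
        have : ∀ v : A → S, ∑ u : A → S, agreeInd A (extend A v) p *
            weight Φ A (glueMap A (extend A u) p) * F (glueMap A (extend A v) p) =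
            agreeInd A (extend A v) p * D.indicator 1 p := by
          intro v
          rw [← Finset.sum_mul, ← Finset.mul_sum]
          by_cases hv : ∀ a ∈ A, p.2 a = extend A v a
          · rw [glueMap_eq_self hv, mul_assoc]
            congr 1
            exact ENNReal.mul_div_cancel (partitionSum_ne_zero A hp) (partitionSum_ne_top A p)
          · have : agreeInd A (extend A v) p = 0 := agreeInd_of_not_agree hv
            simp [this]
        simp only [this]
        rw [← Finset.sum_mul, sum_agreeInd, one_mul]
    _ = μ D := lintegral_indicator_one hD

/-- Gibbs kernels on larger regions produce detailed balance on smaller ones. -/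
theorem detailedBalance_bind (hΦ : Φ.AbsSummable) {A B : Finset G} (hAB : A ⊆ B)
    (μ : Measure (Θ × (G → S))) : DetailedBalance Φ (μ.bind (gibbsKernel Φ B)) A := by
  intro y z F hF
  have h1 := measurable_balance_integrand hΦ A y z z hF
  have h2 := measurable_balance_integrand hΦ A z y z hF
  have hK := (measurable_gibbsKernel hΦ B).aemeasurable (μ := μ)
  rw [Measure.lintegral_bind hK h1.aemeasurable, Measure.lintegral_bind hK h2.aemeasurable]
  refine lintegral_congr fun q => ?_
  rw [lintegral_gibbsKernel B q h1, lintegral_gibbsKernel B q h2]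
  classical
  have hglue : ∀ (t : B → S) (z : G → S),
      glueMap B (extend B fun b : B => glue A z (extend B t) b) q =
        glueMap A z (glueMap B (extend B t) q) := by
    intro t z
    refine Prod.ext rfl (funext fun k => ?_)
    by_cases hB : k ∈ B
    · by_cases hA : k ∈ A <;> simp [glueMap, glue, hB, hA, extend_apply_mem]
    · have hA : k ∉ A := fun h => hB (hAB h)
      simp [glueMap, glue, hB, hA]
  have hback : ∀ (t : B → S) (y z : G → S),
      (∀ a ∈ A, (glueMap B (extend B t) q).2 a = y a) →
      (fun b : B => glue A y (extend B fun b : B => glue A z (extend B t) b) b) = t := by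
    intro t y z ht
    funext ⟨b, hb⟩
    by_cases hA : b ∈ A
    · have := ht b hA
      simp only [glueMap, glue, hb, if_true, extend_apply_mem] at this
      simp [glue, hA, this]
    · simp [glue, hA, extend_apply_mem, hb]
  simp only [agreeInd, Set.indicator_apply, Set.mem_ofPred_eq, ite_mul, mul_ite, Pi.one_apply,
    one_mul, zero_mul, mul_zero]
  rw [← Finset.sum_filter, ← Finset.sum_filter]
  refine Finset.sum_nbij' (fun t b => glue A z (extend B t) b)
    (fun t b => glue A y (extend B t) b) ?_ ?_ ?_ ?_ ?_
  · intro t _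
    rw [Finset.mem_filter, hglue]
    exact ⟨Finset.mem_univ _, fun a ha => by simp [glueMap, glue, ha]⟩
  · intro t _
    rw [Finset.mem_filter, hglue]
    exact ⟨Finset.mem_univ _, fun a ha => by simp [glueMap, glue, ha]⟩
  · exact fun t ht => hback t y z (Finset.mem_filter.1 ht).2
  · exact fun t ht => hback t z y (Finset.mem_filter.1 ht).2
  · intro t ht
    rw [hglue, glueMap_glueMap, glueMap_glueMap, glueMap_eq_self (Finset.mem_filter.1 ht).2]
    have := weight_mul_weight_comm hΦ hAB (p := glueMap B (extend B t) q)
      (q := glueMap A z (glueMap B (extend B t) q)) rfl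
      (fun k hk => by simp [glueMap, glue, hk])
    rw [div_eq_mul_inv, div_eq_mul_inv, mul_assoc, mul_left_comm, ← mul_assoc (weight Φ B _),
      this]
    ring

end DetailedBalance

/-! ### Limits of measures in detailed balance -/

section Limits

variable {Φ : Interaction G S Θ R}

theorem DetailedBalance.of_boxes (hΦ : Φ.AbsSummable) {μ : Measure (Θ × (G → S))}
    [IsFiniteMeasure μ] {A : Finset G}
    (h : ∀ (y z : G → S), ∀ D ∈ boxes Θ G S,
      ∫⁻ p, agreeInd A y p * weight Φ A (glueMap A z p) * D.indicator 1 (glueMap A z p) ∂μ =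
        ∫⁻ p, agreeInd A z p * weight Φ A (glueMap A y p) * D.indicator 1 (glueMap A z p) ∂μ) :
    DetailedBalance Φ μ A := by
  intro y z F hF
  have hd : ∀ y z : G → S, Measurable fun p => agreeInd A y p * weight Φ A (glueMap A z p) :=
    fun y z => (measurable_agreeInd A y).mul
      ((measurable_weight hΦ A).comp (measurable_glueMap A z))
  have hM : ∀ (y z' : G → S) (F : Θ × (G → S) → ℝ≥0∞), Measurable F →
      ∫⁻ p, F p ∂((μ.withDensity fun p => agreeInd A y p * weight Φ A (glueMap A z' p)).map
        (glueMap A z)) =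
      ∫⁻ p, agreeInd A y p * weight Φ A (glueMap A z' p) * F (glueMap A z p) ∂μ := by
    intro y z' F hF
    rw [lintegral_map hF (measurable_glueMap A z)]
    exact lintegral_withDensity_eq_lintegral_mul _ (hd y z') (hF.comp (measurable_glueMap A z))
  have hfin : ∫⁻ p, agreeInd A y p * weight Φ A (glueMap A z p) ∂μ ≠ ∞ := by
    obtain ⟨c, hc⟩ := weight_le hΦ A
    refine ne_top_of_le_ne_top (ENNReal.mul_ne_top ENNReal.ofReal_ne_top (measure_ne_top μ .univ))
      ((lintegral_mono fun p => ?_).trans (lintegral_const (ENNReal.ofReal c)).le)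
    refine (mul_le_mul' ?_ (hc _)).trans (one_mul _).le
    exact Set.indicator_le_self' (fun _ _ => zero_le) p
  have : IsFiniteMeasure (μ.withDensity fun p => agreeInd A y p * weight Φ A (glueMap A z p)) :=
    isFiniteMeasure_withDensity hfin
  rw [← hM y z F hF, ← hM z y F hF]
  congr 1
  refine measure_ext_of_boxes fun D hD => ?_
  have hDm := measurableSet_of_mem_boxes hD
  rw [← lintegral_indicator_one hDm, ← lintegral_indicator_one hDm,
    hM y z _ (measurable_one.indicator hDm), hM z y _ (measurable_one.indicator hDm)]
  exact h y z D hD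

/-- A memory set decides admissibility of a local modification of an admissible configuration. -/
theorem glue_mem_X_iff_extensible {A B : Finset G} (hAB : A ⊆ B)
    (hB : ∀ θ : Θ, ∀ x ∈ R.X θ, ∀ x' ∈ R.X θ, (∀ g ∈ B \ A, x g = x' g) →
      (fun g => if g ∈ B then x g else x' g) ∈ R.X θ)
    {θ : Θ} {x : G → S} (hx : x ∈ R.X θ) (z : G → S) :
    glue A z x ∈ R.X θ ↔ θ ∈ extensible R B (glue A z x) := by
  refine ⟨fun h => ⟨_, h, fun _ _ => rfl⟩, fun ⟨x', hx', h⟩ => ?_⟩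
  convert hB θ x' hx' x hx fun g hg => ?_ using 1
  · funext k
    by_cases hk : k ∈ B
    · simp [hk, h k hk]
    · have hA : k ∉ A := fun h => hk (hAB h)
      simp [glue, hk, hA]
  · rw [Finset.mem_sdiff] at hg
    rw [h g hg.1]
    simp [glue, hg.2]

theorem unifCont_agree (A : Finset G) (y : G → S) :
    UnifCont (Set.indicator {p : Θ × (G → S) | ∀ a ∈ A, p.2 a = y a} fun _ => (1 : ℝ)) := by
  refine .indicator_of_local A (fun x => ?_) fun θ x z hxz => ?_
  · exact MeasurableSet.const (∀ a ∈ A, x a = y a)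
  · change (∀ a ∈ A, x a = y a) ↔ ∀ a ∈ A, z a = y a
    exact forall₂_congr fun a ha => by rw [hxz a ha]

/-- On `Ω`, the integrands of the detailed balance relation have relatively continuous versions. -/
theorem exists_unifCont_version [StandardBorelSpace Θ] (hTMP : R.WeakTMP) (hΦ : Φ.AbsSummable)
    (ν : Measure Θ) [IsFiniteMeasure ν] (A : Finset G) (y z z' : G → S) {D : Set (Θ × (G → S))}
    (hD : D ∈ boxes Θ G S) :
    ∃ h : Θ × (G → S) → ℝ, UnifCont h ∧ (∀ p, 0 ≤ h p) ∧
      ∀ μ : Measure (Θ × (G → S)), μ.map Prod.fst = ν → (∀ᵐ p ∂μ, p ∈ R.Omega) →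
        ∫⁻ p, agreeInd A y p * weight Φ A (glueMap A z p) * D.indicator 1 (glueMap A z' p) ∂μ =
          ∫⁻ p, ENNReal.ofReal (h p) ∂μ := by
  obtain ⟨B, hAB, hB⟩ := hTMP A
  refine ⟨fun p => (Set.indicator {p : Θ × (G → S) | ∀ a ∈ A, p.2 a = y a} (fun _ => (1 : ℝ)) p *
    ({p : Θ × (G → S) | p.1 ∈ extensibleVersion R ν B (glue A z p.2)}.indicator
      (fun _ => (1 : ℝ)) p * Real.exp (-condEnergy Φ A (glueMap A z p)))) *
    D.indicator (fun _ => (1 : ℝ)) (glueMap A z' p), ?_, ?_, ?_⟩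
  · exact ((unifCont_agree A y).mul ((unifCont_extensibleVersion_glue R ν A B z).mul
      ((unifCont_condEnergy hΦ A).comp_glueMap A z).exp_neg)).mul
      ((UnifCont.indicator_box hD).comp_glueMap A z')
  · intro p
    have h0 : ∀ (s : Set (Θ × (G → S))) q, 0 ≤ s.indicator (fun _ => (1 : ℝ)) q :=
      fun s q => Set.indicator_nonneg (fun _ _ => zero_le_one) q
    exact mul_nonneg (mul_nonneg (h0 _ _) (mul_nonneg (h0 _ _) (Real.exp_pos _).le)) (h0 _ _)
  · intro μ hμν hμ
    have hν : ∀ᵐ p ∂μ, ∀ C x, p.1 ∈ extensibleVersion R ν C x ↔ p.1 ∈ extensible R C x := by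
      have := ae_mem_extensibleVersion_iff R ν
      rw [← hμν] at this
      rw [← hμν]
      exact ae_of_ae_map measurable_fst.aemeasurable this
    refine lintegral_congr_ae ?_
    filter_upwards [hμ, hν] with p hp hpν
    have hiff : glueMap A z p ∈ R.Omega ↔ p.1 ∈ extensibleVersion R ν B (glue A z p.2) := by
      rw [hpν]
      exact glue_mem_X_iff_extensible hAB hB hp z
    by_cases h1 : ∀ a ∈ A, p.2 a = y a
    swap
    · rw [agreeInd_of_not_agree h1,
        Set.indicator_of_notMem (show p ∉ {p : Θ × (G → S) | ∀ a ∈ A, p.2 a = y a} from h1)]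
      simp
    by_cases h2 : glueMap A z p ∈ R.Omega
    swap
    · simp [weight, h2, mt hiff.2 h2]
    by_cases h3 : glueMap A z' p ∈ D
    swap
    · simp [h3]
    rw [agreeInd_of_agree h1,
      Set.indicator_of_mem (show p ∈ {p : Θ × (G → S) | ∀ a ∈ A, p.2 a = y a} from h1)]
    simp [weight, h2, hiff.1 h2, h3]

theorem DetailedBalance.of_tendsto [StandardBorelSpace Θ] (hTMP : R.WeakTMP)
    (hΦ : Φ.AbsSummable) {ν : Measure Θ} [IsFiniteMeasure ν] {ι : Type*} {l : Filter ι} [l.NeBot]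
    {μ : ι → Measure (Θ × (G → S))} (hμ : ∀ i, IsProbabilityMeasure (μ i))
    (hμν : ∀ i, (μ i).map Prod.fst = ν) (hμR : ∀ i, ∀ᵐ p ∂(μ i), p ∈ R.Omega)
    {ρ : Measure (Θ × (G → S))} [IsProbabilityMeasure ρ] (hρν : ρ.map Prod.fst = ν)
    (hρR : ∀ᵐ p ∂ρ, p ∈ R.Omega)
    (hlim : ∀ h, UnifCont h → Tendsto (fun i => ∫ p, h p ∂(μ i)) l (𝓝 (∫ p, h p ∂ρ)))
    {A : Finset G} (h : ∀ᶠ i in l, DetailedBalance Φ (μ i) A) : DetailedBalance Φ ρ A := by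
  refine .of_boxes hΦ fun y z D hD => ?_
  obtain ⟨k, hk, hk0, hkμ⟩ := exists_unifCont_version hTMP hΦ ν A y z z hD
  obtain ⟨k', hk', hk0', hkμ'⟩ := exists_unifCont_version hTMP hΦ ν A z y z hD
  rw [hkμ ρ hρν hρR, hkμ' ρ hρν hρR]
  refine tendsto_nhds_unique_of_eventuallyEq (hk.tendsto_lintegral hμ hlim hk0)
    (hk'.tendsto_lintegral hμ hlim hk0') ?_
  filter_upwards [h] with i hi
  rw [← hkμ _ (hμν i) (hμR i), ← hkμ' _ (hμν i) (hμR i)]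
  exact hi y z _ (measurable_one.indicator (measurableSet_of_mem_boxes hD))

/-- Limits of measures on `Ω` that are eventually in detailed balance on each finite set. -/
theorem exists_detailedBalance_limit [StandardBorelSpace Θ] (hTMP : R.WeakTMP)
    (hΦ : Φ.AbsSummable) (ν : Measure Θ) [IsProbabilityMeasure ν] {ι : Type*} (l : Ultrafilter ι)
    {μ : ι → Measure (Θ × (G → S))} (hμ : ∀ i, IsProbabilityMeasure (μ i))
    (hμν : ∀ i, (μ i).map Prod.fst = ν) (hμR : ∀ i, ∀ᵐ p ∂(μ i), p ∈ R.Omega)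
    (h : ∀ A, ∀ᶠ i in l, DetailedBalance Φ (μ i) A) :
    ∃ ρ : Measure (Θ × (G → S)), IsProbabilityMeasure ρ ∧ ρ.map Prod.fst = ν ∧
      (∀ᵐ p ∂ρ, p ∈ R.Omega) ∧ (∀ A, DetailedBalance Φ ρ A) ∧
      ∀ h, UnifCont h → Tendsto (fun i => ∫ p, h p ∂(μ i)) l (𝓝 (∫ p, h p ∂ρ)) := by
  obtain ⟨ρ, hρ, hρν, hlim⟩ := exists_ultrafilter_limit ν l μ hμ hμν
  have hρR := ae_mem_Omega_of_tendsto R ν hμ hρν hlim fun A =>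
    Eventually.of_forall fun i => ae_mem_extensibleVersion_of_Omega R ν (hμR i) A
  exact ⟨ρ, hρ, hρν, hρR,
    fun A => DetailedBalance.of_tendsto hTMP hΦ hμ hμν hμR hρν hρR hlim (h A), hlim⟩

theorem gibbsKernel_univ (A : Finset G) {p : Θ × (G → S)} (hp : p ∈ R.Omega) :
    gibbsKernel Φ A p Set.univ = 1 := by
  have := lintegral_gibbsKernel (Φ := Φ) A p (measurable_const (a := (1 : ℝ≥0∞)))
  rw [lintegral_one] at this
  simp only [this, mul_one, div_eq_mul_inv]
  rw [← Finset.sum_mul]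
  exact ENNReal.mul_inv_cancel (partitionSum_ne_zero A hp) (partitionSum_ne_top A p)

theorem gibbsKernel_compl_Omega (A : Finset G) (p : Θ × (G → S)) :
    gibbsKernel Φ A p R.Omegaᶜ = 0 := by
  have hO : MeasurableSet R.Omegaᶜ := R.omega_measurable.compl
  rw [← lintegral_indicator_one hO, lintegral_gibbsKernel A p (measurable_one.indicator hO)]
  refine Finset.sum_eq_zero fun u _ => ?_
  by_cases h : glueMap A (extend A u) p ∈ R.Omega <;> simp [weight, h]

theorem gibbsKernel_fst_preimage (A : Finset G) {p : Θ × (G → S)} (hp : p ∈ R.Omega)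
    {E : Set Θ} (hE : MeasurableSet E) :
    gibbsKernel Φ A p (Prod.fst ⁻¹' E) = (Prod.fst ⁻¹' E).indicator 1 p := by
  have hE' : MeasurableSet (Prod.fst ⁻¹' E : Set (Θ × (G → S))) := measurable_fst hE
  rw [← lintegral_indicator_one hE', lintegral_gibbsKernel A p (measurable_one.indicator hE')]
  have : ∀ u : A → S, (Prod.fst ⁻¹' E).indicator (1 : Θ × (G → S) → ℝ≥0∞)
      (glueMap A (extend A u) p) = (Prod.fst ⁻¹' E).indicator 1 p := fun u => rfl
  simp only [this]
  have h1 := gibbsKernel_univ (Φ := Φ) A hp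
  have h2 := lintegral_gibbsKernel (Φ := Φ) A p (measurable_const (a := (1 : ℝ≥0∞)))
  rw [lintegral_one, h1] at h2
  simp only [mul_one] at h2
  rw [← Finset.sum_mul, ← h2, one_mul]

/-- Existence of relative Gibbs measures, in the form of detailed balance. -/
theorem exists_detailedBalance [StandardBorelSpace Θ] (hfibers : ∀ θ, (R.X θ).Nonempty)
    (hTMP : R.WeakTMP) (hΦ : Φ.AbsSummable) (ν : Measure Θ) [IsProbabilityMeasure ν] :
    ∃ μ : Measure (Θ × (G → S)), IsProbabilityMeasure μ ∧ μ.map Prod.fst = ν ∧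
      (∀ᵐ p ∂μ, p ∈ R.Omega) ∧ ∀ A, DetailedBalance Φ μ A := by
  obtain ⟨m, hm, hmν, hmR⟩ := exists_measure_Omega R hfibers ν
  have hK := fun B => (measurable_gibbsKernel hΦ B).aemeasurable (μ := m)
  have hfst : ∀ B, (m.bind (gibbsKernel Φ B)).map Prod.fst = ν := by
    intro B
    ext E hE
    rw [Measure.map_apply measurable_fst hE, Measure.bind_apply (measurable_fst hE) (hK B),
      ← hmν, Measure.map_apply measurable_fst hE, ← lintegral_indicator_one (measurable_fst hE)]
    refine lintegral_congr_ae ?_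
    filter_upwards [hmR] with p hp
    exact gibbsKernel_fst_preimage B hp hE
  have hprob : ∀ B, IsProbabilityMeasure (m.bind (gibbsKernel Φ B)) := by
    intro B
    refine ⟨?_⟩
    have := congrArg (fun η => η Set.univ) (hfst B)
    simpa [Measure.map_apply measurable_fst] using this
  obtain ⟨μ, hμ, hμν, hμR, hDB, -⟩ := exists_detailedBalance_limit hTMP hΦ ν
    (Ultrafilter.of (atTop : Filter (Finset G))) hprob hfst
    (fun B => by
      have hO : MeasurableSet R.Omegaᶜ := R.omega_measurable.compl
      change m.bind (gibbsKernel Φ B) R.Omegaᶜ = 0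
      rw [Measure.bind_apply hO (hK B)]
      simp [gibbsKernel_compl_Omega])
    fun A => Ultrafilter.of_le _ ((eventually_ge_atTop A).mono fun B hAB =>
      detailedBalance_bind hΦ hAB m)
  exact ⟨μ, hμ, hμν, hμR, hDB⟩

end Limits

/-! ### Invariance -/

section Invariance

variable {Φ : Interaction G S Θ R}

theorem agreeInd_translate (g : G) (A : Finset G) (y : G → S) (p : Θ × (G → S)) :
    agreeInd (A.image (g * ·)) (shift G S g y) (actMap R g p) = agreeInd A y p := by
  have : (∀ a ∈ A.image (g * ·), (actMap R g p).2 a = shift G S g y a) ↔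
      ∀ a ∈ A, p.2 a = y a := by
    simp only [Finset.forall_mem_image, actMap, shift, inv_mul_cancel_left]
  by_cases h : ∀ a ∈ A, p.2 a = y a
  · rw [agreeInd_of_agree h, agreeInd_of_agree (this.2 h)]
  · rw [agreeInd_of_not_agree h, agreeInd_of_not_agree (mt this.1 h)]

theorem weight_translate (g : G) (A : Finset G) (p : Θ × (G → S)) :
    weight Φ (A.image (g * ·)) (actMap R g p) = weight Φ A p := by
  by_cases h : p ∈ R.Omega
  · rw [weight, Set.indicator_of_mem ((mem_Omega_actMap R g p).2 h), condEnergy_translate, weight,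
      Set.indicator_of_mem h]
  · rw [weight, Set.indicator_of_notMem (mt (mem_Omega_actMap R g p).1 h), weight,
      Set.indicator_of_notMem h]

theorem DetailedBalance.map_actMap (hΦ : Φ.AbsSummable) {μ : Measure (Θ × (G → S))} (g : G)
    {A : Finset G} (h : DetailedBalance Φ μ A) :
    DetailedBalance Φ (μ.map (actMap R g)) (A.image (g * ·)) := by
  have hs : Function.Surjective (shift G S g) := fun y =>
    ⟨shift G S g⁻¹ y, funext fun k => by simp [shift]⟩
  intro y z F hF
  obtain ⟨y, rfl⟩ := hs y
  obtain ⟨z, rfl⟩ := hs z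
  rw [lintegral_map (measurable_balance_integrand hΦ _ _ _ _ hF) (measurable_actMap R g),
    lintegral_map (measurable_balance_integrand hΦ _ _ _ _ hF) (measurable_actMap R g)]
  simp only [← actMap_glueMap, agreeInd_translate, weight_translate]
  exact h y z (F ∘ actMap R g) (hF.comp (measurable_actMap R g))

theorem detailedBalance_map_actMap (hΦ : Φ.AbsSummable) {μ : Measure (Θ × (G → S))}
    (h : ∀ A, DetailedBalance Φ μ A) (g : G) (A : Finset G) :
    DetailedBalance Φ (μ.map (actMap R g)) A := by
  have := (h (A.image (g⁻¹ * ·))).map_actMap hΦ g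
  rwa [image_mul_left_inv] at this

theorem DetailedBalance.smul_sum {ι : Type*} {μ : ι → Measure (Θ × (G → S))} {A : Finset G}
    (h : ∀ i, DetailedBalance Φ (μ i) A) (c : ℝ≥0∞) (s : Finset ι) :
    DetailedBalance Φ (c • ∑ i ∈ s, μ i) A := by
  intro y z F hF
  rw [lintegral_smul_measure, lintegral_smul_measure, lintegral_finsetSum_measure,
    lintegral_finsetSum_measure, Finset.sum_congr rfl fun i _ => h i y z F hF]

/-- The average of the translates of `μ` by the inverses of the elements of `F`. -/
def average (R : RelSystem G S Θ) (μ : Measure (Θ × (G → S))) (F : Finset G) :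
    Measure (Θ × (G → S)) :=
  (F.card : ℝ≥0∞)⁻¹ • ∑ g ∈ F, μ.map (actMap R g⁻¹)

theorem average_map_fst {μ : Measure (Θ × (G → S))} {ν : Measure Θ} (hμν : μ.map Prod.fst = ν)
    (hν : ∀ g, ν.map (R.act g) = ν) {F : Finset G} (hF : F.Nonempty) :
    (average R μ F).map Prod.fst = ν := by
  have h : ∀ g, (μ.map (actMap R g)).map Prod.fst = ν := by
    intro g
    rw [Measure.map_map measurable_fst (measurable_actMap R g)]
    have : Prod.fst ∘ actMap R g = R.act g ∘ Prod.fst := rfl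
    rw [this, ← Measure.map_map (R.act_measurable g) measurable_fst, hμν, hν]
  ext E hE
  rw [Measure.map_apply measurable_fst hE, average, Measure.smul_apply, Measure.finsetSum_apply]
  have h' : ∀ g, (μ.map (actMap R g)) (Prod.fst ⁻¹' E) = ν E := fun g => by
    rw [← Measure.map_apply measurable_fst hE, h]
  simp only [h', Finset.sum_const, nsmul_eq_mul, smul_eq_mul]
  rw [← mul_assoc, ENNReal.inv_mul_cancel (by simpa using hF.ne_empty) (by simp), one_mul]

theorem ae_average {μ : Measure (Θ × (G → S))} (hμ : ∀ᵐ p ∂μ, p ∈ R.Omega) (F : Finset G) :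
    ∀ᵐ p ∂(average R μ F), p ∈ R.Omega := by
  change average R μ F R.Omegaᶜ = 0
  rw [average, Measure.smul_apply, Measure.finsetSum_apply, Finset.sum_eq_zero, smul_zero]
  intro g _
  have hO : MeasurableSet R.Omegaᶜ := R.omega_measurable.compl
  rw [Measure.map_apply (measurable_actMap R _) hO]
  have : actMap R g⁻¹ ⁻¹' R.Omegaᶜ = R.Omegaᶜ :=
    Set.ext fun p => not_congr (mem_Omega_actMap R g⁻¹ p)
  rw [this]
  exact hμ

theorem integral_average {μ : Measure (Θ × (G → S))} [IsFiniteMeasure μ] {k : Θ × (G → S) → ℝ}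
    (hk : UnifCont k) (F : Finset G) :
    ∫ p, k p ∂(average R μ F) = (F.card : ℝ)⁻¹ * ∑ g ∈ F, ∫ p, k (actMap R g⁻¹ p) ∂μ := by
  rw [average, integral_smul_measure, integral_finsetSum_measure fun g _ => hk.integrable _]
  simp only [ENNReal.toReal_inv, ENNReal.toReal_natCast, smul_eq_mul]
  congr 1
  refine Finset.sum_congr rfl fun g _ => ?_
  exact integral_map (measurable_actMap R _).aemeasurable hk.measurable.aestronglyMeasurable

theorem tendsto_average_actMap {μ : Measure (Θ × (G → S))} [IsProbabilityMeasure μ]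
    {F : ℕ → Finset G} (hF : RightFolner F) {k : Θ × (G → S) → ℝ} (hk : UnifCont k) (g : G) :
    Tendsto (fun n => ∫ p, k (actMap R g p) ∂(average R μ (F n)) - ∫ p, k p ∂(average R μ (F n)))
      atTop (𝓝 0) := by
  obtain ⟨c, hc⟩ := hk.bounded
  set a : G → ℝ := fun j => ∫ p, k (actMap R j⁻¹ p) ∂μ with ha
  have hac : ∀ j, |a j| ≤ c := fun j => by
    simpa using norm_integral_le_of_norm_le_const (μ := μ)
      (f := fun p => k (actMap R j⁻¹ p)) (ae_of_all _ fun p => hc (actMap R j⁻¹ p))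
  refine squeeze_zero_norm (a := fun n => c *
    (((symmDiff (F n) ((F n).image (· * g⁻¹))).card : ℝ) / (F n).card)) (fun n => ?_) ?_
  swap
  · simpa using (hF.2 g⁻¹).const_mul c
  rw [integral_average (hk.comp_actMap R g), integral_average hk, ← mul_sub]
  have h1 : ∑ j ∈ F n, ∫ p, k (actMap R g (actMap R j⁻¹ p)) ∂μ =
      ∑ j ∈ (F n).image (· * g⁻¹), a j := by
    rw [Finset.sum_image fun _ _ _ _ h => mul_right_cancel h]
    refine Finset.sum_congr rfl fun j _ => ?_
    simp only [ha, mul_inv_rev, inv_inv, actMap_mul]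
  rw [h1, ← Finset.sum_sdiff_sub_sum_sdiff, norm_mul, norm_inv, Real.norm_natCast,
    mul_div_assoc', inv_mul_eq_div]
  refine div_le_div_of_nonneg_right ?_ (Nat.cast_nonneg _)
  have hs : ∀ s : Finset G, ‖∑ j ∈ s, a j‖ ≤ c * s.card := fun s => by
    refine (norm_sum_le_of_le s fun j _ => hac j).trans ?_
    simp [mul_comm]
  refine (norm_sub_le _ _).trans ((add_le_add (hs _) (hs _)).trans (le_of_eq ?_))
  rw [← mul_add, symmDiff, Finset.sup_eq_union, Finset.card_union_of_disjoint disjoint_sdiff_sdiff,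
    Nat.cast_add, add_comm]

end Invariance

/-- **Existence of invariant relative Gibbs measures**: if `Θ` is standard Borel,
the fibers are nonempty, `G` admits a right Følner sequence, and `Ω` has the weak
topological Markov property relative to `Θ`, then for every `G`-invariant probability
measure `ν` on `Θ` and every absolutely summable relative interaction `Φ` there is a
`G`-invariant relative Gibbs measure for `Φ` with marginal `ν`. -/
theorem existence_invariant_relative_gibbs
    {G : Type} [Group G] [Countable G] [DecidableEq G]
    {S : Type} [Fintype S] [Nonempty S] [TopologicalSpace S] [DiscreteTopology S]
    [MeasurableSpace S] [MeasurableSingletonClass S]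
    {Θ : Type} [MeasurableSpace Θ] [StandardBorelSpace Θ]
    (hFolner : ∃ F : ℕ → Finset G, RightFolner F)
    (R : RelSystem G S Θ) (hfibers : ∀ θ : Θ, (R.X θ).Nonempty)
    (hTMP : R.WeakTMP)
    (ν : Measure Θ) [IsProbabilityMeasure ν]
    (hνinv : ∀ g : G, ν.map (R.act g) = ν)
    (Φ : Interaction G S Θ R) (hΦ : Φ.AbsSummable) :
    ∃ μ : Measure (Θ × (G → S)), IsProbabilityMeasure μ ∧ μ R.Omega = 1 ∧
      μ.map Prod.fst = ν ∧
      (∀ g : G, μ.map (fun p => (R.act g p.1, shift G S g p.2)) = μ) ∧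
      ∀ A : Finset G, μ.bind (gibbsKernel Φ A) = μ := by
  obtain ⟨F, hF⟩ := hFolner
  obtain ⟨m, hm, hmν, hmR, hmDB⟩ := exists_detailedBalance hfibers hTMP hΦ ν
  have hfst : ∀ n, (average R m (F n)).map Prod.fst = ν := fun n =>
    average_map_fst hmν hνinv (hF.1 n)
  have hprob : ∀ n, IsProbabilityMeasure (average R m (F n)) := by
    intro n
    refine ⟨?_⟩
    have := congrArg (fun η => η Set.univ) (hfst n)
    simpa [Measure.map_apply measurable_fst] using this
  obtain ⟨μ, hμ, hμν, hμR, hDB, hlim⟩ := exists_detailedBalance_limit hTMP hΦ ν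
    (Ultrafilter.of (atTop : Filter ℕ)) hprob hfst (fun n => ae_average hmR (F n))
    fun A => Eventually.of_forall fun n =>
      .smul_sum (fun g => detailedBalance_map_actMap hΦ hmDB g⁻¹ A) _ (F n)
  refine ⟨μ, hμ, ?_, hμν, fun g => ?_, fun A => (hDB A).bind_gibbsKernel hΦ hμR⟩
  · exact (prob_compl_eq_zero_iff R.omega_measurable).1 hμR
  · change μ.map (actMap R g) = μ
    have hμ' : IsProbabilityMeasure (μ.map (actMap R g)) :=
      Measure.isProbabilityMeasure_map (measurable_actMap R g).aemeasurable
    refine measure_ext_of_boxes fun D hD => ?_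
    have hk := UnifCont.indicator_box hD
    have hDm := measurableSet_of_mem_boxes hD
    have h0 := tendsto_nhds_unique
      ((hlim _ (hk.comp_actMap R g)).sub (hlim _ hk))
      ((tendsto_average_actMap (μ := m) hF hk g).mono_left (Ultrafilter.of_le _))
    rw [sub_eq_zero, ← integral_map (measurable_actMap R g).aemeasurable
      hk.measurable.aestronglyMeasurable] at h0
    rw [← measureReal_eq_measureReal_iff, ← integral_indicator_one hDm,
      ← integral_indicator_one hDm]
    exact h0

end DLR
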